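/- arXiv:1310.6084 — 6 statements merged into one kernel-verified Lean document; each statement's English description precedes it below -/
import Mathlib

section
/- There exists a constant C > 0 such that the following holds. Let G be a connected finite simple graph on n ≥ 1 vertices that admits a planar straight-line drawing in ℝ². Then G has a spanning tree T and a monotone grid drawing g : V → ℤ² with all vertices placed in [0, C·n] × [0, C·n²] such that, moreover, every pair of distinct vertices of G is joined by a monotone path all of whose edges are edges of T. -/
open SimpleGraph

/-- Dot product on `ℝ × ℝ`. -/
def dot (p q : ℝ × ℝ) : ℝ := p.1 * q.1 + p.2 * q.2

/-- The real point corresponding to a grid point. -/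
def gridMap {V : Type} (g : V → ℤ × ℤ) : V → ℝ × ℝ :=
  fun v => (((g v).1 : ℝ), ((g v).2 : ℝ))

/-- `f` is a planar (crossing-free) straight-line drawing of `G`. -/
def IsPlanarDrawing {V : Type} (G : SimpleGraph V) (f : V → ℝ × ℝ) : Prop :=
  Function.Injective f ∧
  (∀ a b c d : V, G.Adj a b → G.Adj c d → s(a, b) ≠ s(c, d) →
    ∀ p : ℝ × ℝ, p ∈ segment ℝ (f a) (f b) → p ∈ segment ℝ (f c) (f d) →
      ∃ x : V, (x = a ∨ x = b) ∧ (x = c ∨ x = d) ∧ p = f x) ∧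
  (∀ a b c : V, G.Adj a b → c ≠ a → c ≠ b → f c ∉ openSegment ℝ (f a) (f b))

/-- The walk `w` is monotone with respect to some direction in the drawing `f`. -/
def MonotoneWalk {V : Type} {G : SimpleGraph V} (f : V → ℝ × ℝ) {a b : V}
    (w : G.Walk a b) : Prop :=
  ∃ d : ℝ × ℝ, d ≠ 0 ∧ w.support.Chain' (fun x y => 0 < dot (f y - f x) d)

/-- `f` is a monotone (planar straight-line) drawing of `G`. -/
def IsMonotoneDrawing {V : Type} (G : SimpleGraph V) (f : V → ℝ × ℝ) : Prop :=
  IsPlanarDrawing G f ∧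
  ∀ a b : V, a ≠ b → ∃ w : G.Walk a b, w.IsPath ∧ MonotoneWalk f w

namespace MonotoneGrid
section Lists

theorem prod_map_eq_of_sublist {α M : Type*} [Monoid M] {l' l : List α} (h : l'.Sublist l)
    (hn : l.Nodup) (g : α → M) (h1 : ∀ x ∈ l, x ∉ l' → g x = 1) :
    (l.map g).prod = (l'.map g).prod := by
  induction h with
  | slnil => rfl
  | @cons l₁ l₂ a h ih =>
    rw [List.nodup_cons] at hn
    rw [List.map_cons, List.prod_cons, h1 a (by simp) fun ha => hn.1 (h.subset ha), one_mul]
    exact ih hn.2 fun x hx => h1 x (List.mem_cons_of_mem _ hx)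
  | @cons_cons l₁ l₂ a h ih =>
    rw [List.nodup_cons] at hn
    rw [List.map_cons, List.prod_cons, List.map_cons, List.prod_cons, ih hn.2]
    intro x hx hx'
    refine h1 x (List.mem_cons_of_mem _ hx) ?_
    rintro (_ | ⟨_, h⟩)
    · exact hn.1 hx
    · contradiction

theorem prod_map_eq_one_of_pair {α M : Type*} [Monoid M] {l : List α} (hn : l.Nodup) (g : α → M)
    {p q : α} (hp : p ∈ l) (hq : q ∈ l) (hpq : p ≠ q) {a : M} (ha : a * a = 1) (hgp : g p = a)
    (hgq : g q = a) (h1 : ∀ x ∈ l, x ≠ p → x ≠ q → g x = 1) : (l.map g).prod = 1 := by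
  obtain ⟨s, t, rfl⟩ := List.append_of_mem hp
  have key : [p, q].Sublist (s ++ p :: t) ∨ [q, p].Sublist (s ++ p :: t) := by
    rcases List.mem_append.1 hq with hq | hq
    · right
      exact (List.singleton_sublist.2 hq).append (List.singleton_sublist.2 (by simp : p ∈ p :: t))
    · left
      have : q ∈ t := by simpa [hpq.symm] using hq
      exact ((List.singleton_sublist.2 this).cons_cons p).trans (List.sublist_append_right _ _)
  rcases key with h | h
  · rw [prod_map_eq_of_sublist h hn g fun x hx hx' => ?_]
    · simp [hgp, hgq, ha]
    · simp at hx'; exact h1 x hx hx'.1 hx'.2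
  · rw [prod_map_eq_of_sublist h hn g fun x hx hx' => ?_]
    · simp [hgp, hgq, ha]
    · simp at hx'; exact h1 x hx hx'.2 hx'.1

theorem append_lt_of_lt_of_not_prefix {p w : List ℕ} (x : List ℕ) (h : p < w)
    (hp : ¬ p <+: w) : p ++ x < w := by
  induction p generalizing w with
  | nil => simp at hp
  | cons a p ih =>
    cases w with
    | nil => simp at h
    | cons b w =>
      rw [List.cons_append, List.cons_lt_cons_iff]
      rw [List.cons_lt_cons_iff] at h
      rcases h with h | ⟨rfl, h⟩
      · exact Or.inl h
      · exact Or.inr ⟨rfl, ih h fun h' => hp (by simpa using h')⟩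

theorem le_append_self (p x : List ℕ) : p ≤ p ++ x := by
  induction p with
  | nil => exact not_lt.1 (List.not_lt_nil x)
  | cons a p ih =>
    rw [List.cons_append, ← not_lt, List.cons_lt_cons_iff]
    rintro (h | ⟨-, h⟩)
    · exact lt_irrefl _ h
    · exact not_lt.2 ih h

theorem append_lt_append_self (p : List ℕ) {i j : ℕ} (h : i < j) : p ++ [i] < p ++ [j] := by
  induction p with
  | nil => simpa [List.cons_lt_cons_iff] using h
  | cons a p ih => simpa [List.cons_lt_cons_iff] using ih

theorem lt_iff_append_lt {p w : List ℕ} (x : List ℕ) (hp : ¬ p <+: w) :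
    p < w ↔ p ++ x < w :=
  ⟨fun h => append_lt_of_lt_of_not_prefix x h hp, fun h => (le_append_self p x).trans_lt h⟩

/-- Among finitely many points on a line carrying pairwise non-crossing chords, some point is
joined only to its immediate neighbours. -/
theorem exists_short_chords {V K : Type*} [LinearOrder K] (s : Finset V) (hs : s.Nonempty)
    (κ : V → K) (hκ : Set.InjOn κ s) (G : SimpleGraph V)
    (hG : ∀ a ∈ s, ∀ b ∈ s, ∀ c ∈ s, ∀ d ∈ s, κ a < κ b → κ b < κ c → κ c < κ d →
      G.Adj a c → G.Adj b d → False) :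
    ∃ v ∈ s, ∀ u ∈ s, G.Adj v u → ∀ w ∈ s, w ≠ u → w ≠ v → (κ v < κ w ↔ κ u < κ w) := by
  classical
  by_contra! hcon
  let N : V × V → Finset V := fun e => s.filter fun w => κ e.1 < κ w ∧ κ w < κ e.2
  let P : Finset (V × V) := (s ×ˢ s).filter fun e => G.Adj e.1 e.2 ∧ (N e).Nonempty
  have hlong : ∀ v ∈ s, ∃ u ∈ s, G.Adj v u ∧ ∃ w ∈ s,
      (κ v < κ w ∧ κ w < κ u) ∨ (κ u < κ w ∧ κ w < κ v) := by
    intro v hv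
    obtain ⟨u, hu, huv, w, hw, hwu, hwv, h⟩ := hcon v hv
    have h1 : κ w ≠ κ u := fun e => hwu (hκ hw hu e)
    have h2 : κ w ≠ κ v := fun e => hwv (hκ hw hv e)
    refine ⟨u, hu, huv, w, hw, ?_⟩
    rcases h with h | h
    · exact Or.inl ⟨h.1, lt_of_le_of_ne h.2 h1⟩
    · exact Or.inr ⟨h.2, lt_of_le_of_ne h.1 h2⟩
  have hmem : ∀ v u w, v ∈ s → u ∈ s → w ∈ s → G.Adj v u → κ v < κ w → κ w < κ u →
      (v, u) ∈ P := by
    intro v u w hv hu hw hvu h1 h2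
    simp only [P, N, Finset.mem_filter, Finset.mem_product]
    exact ⟨⟨hv, hu⟩, hvu, w, by simp [hw, h1, h2]⟩
  have hP : P.Nonempty := by
    obtain ⟨v, hv⟩ := hs
    obtain ⟨u, hu, hvu, w, hw, h | h⟩ := hlong v hv
    · exact ⟨_, hmem v u w hv hu hw hvu h.1 h.2⟩
    · exact ⟨_, hmem u v w hu hv hw hvu.symm h.1 h.2⟩
  obtain ⟨⟨a, b⟩, hab, hmin⟩ := P.exists_min_image (fun e => (N e).card) hP
  simp only [P, Finset.mem_filter, Finset.mem_product] at hab
  obtain ⟨⟨ha, hb⟩, hab, v, hv⟩ := hab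
  simp only [N, Finset.mem_filter] at hv
  obtain ⟨hv, hav, hvb⟩ := hv
  have hless : ∀ e ∈ P, κ a ≤ κ e.1 → κ e.2 ≤ κ b → v ∉ N e → False := by
    intro e he h1 h2 h3
    refine absurd (hmin e he) (not_le.2 (Finset.card_lt_card ?_))
    refine (Finset.ssubset_iff_of_subset ?_).2 ⟨v, by simp [N, hv, hav, hvb], h3⟩
    intro w
    simp only [N, Finset.mem_filter]
    exact fun h => ⟨h.1, h1.trans_lt h.2.1, h.2.2.trans_le h2⟩
  obtain ⟨u, hu, hvu, w, hw, h | h⟩ := hlong v hv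
  · refine hless _ (hmem v u w hv hu hw hvu h.1 h.2) hav.le ?_ (by simp [N])
    by_contra! hlt
    exact hG a ha v hv b hb u hu hav hvb hlt hab hvu
  · refine hless _ (hmem u v w hu hv hw hvu.symm h.1 h.2) ?_ hvb.le (by simp [N])
    by_contra! hlt
    exact hG u hu a ha v hv b hb hlt hav hvb hvu.symm hab

theorem nodup_replace {α : Type*} {A B D : List α} {x : α} (h : (A ++ x :: B).Nodup)
    (hD : D.Nodup) (hdisj : ∀ e ∈ D, e ∉ A ∧ e ∉ B) : (A ++ D ++ B).Nodup := by
  simp only [List.nodup_append, List.nodup_cons, List.mem_append, List.mem_cons] at h ⊢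
  grind

end Lists

section Peeling

/-- An assignment of permutations to the darts of a graph that inverts under dart reversal. -/
def IsGauge {V : Type} (μ : V → V → Equiv.Perm (Fin 3)) : Prop :=
  ∀ u v, μ v u = (μ u v)⁻¹

/-- A rotation system on `G`: each `rot v` lists the neighbours of `v`. -/
structure IsRotation {V : Type} (G : SimpleGraph V) (rot : V → List V) : Prop where
  nodup : ∀ v, (rot v).Nodup
  mem_iff : ∀ v u, u ∈ rot v ↔ G.Adj v u

/-- Every gauge whose holonomy around each vertex of `R` is trivial has trivial holonomy along
the word of darts `w`. This is the form in which planarity is used. -/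
def Bounds {V : Type} (rot : V → List V) (R : Set V) (w : List (V × V)) : Prop :=
  ∀ μ : V → V → Equiv.Perm (Fin 3), IsGauge μ →
    (∀ v ∈ R, ((rot v).map (μ v)).prod = 1) → (w.map fun e => μ e.1 e.2).prod = 1

/-- Two paths `p₁ c₁ c₃ p₃` and `p₂ c₂ c₄ p₄` whose ends alternate along a word that bounds `R`
cannot both exist: two transpositions in `Fin 3` that do not commute, one along each path,
would give a gauge with nontrivial holonomy along the word. -/
theorem Bounds.not_crossing {V : Type} {G : SimpleGraph V} {rot : V → List V}
    (hrot : IsRotation G rot) {R : Set V} {w : List (V × V)} (hB : Bounds rot R w)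
    (hw : w.Nodup) (hwR : ∀ e ∈ w, e.1 ∉ R) {p₁ c₁ p₂ c₂ p₃ c₃ p₄ c₄ : V}
    (hs : [(p₁, c₁), (p₂, c₂), (p₃, c₃), (p₄, c₄)].Sublist w)
    (hc : [c₁, c₂, c₃, c₄].Nodup) (hR : ∀ c ∈ [c₁, c₂, c₃, c₄], c ∈ R)
    (h₁ : G.Adj p₁ c₁) (h₂ : G.Adj p₂ c₂) (h₃ : G.Adj p₃ c₃) (h₄ : G.Adj p₄ c₄)
    (h₁₃ : G.Adj c₁ c₃) (h₂₄ : G.Adj c₂ c₄) : False := by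
  classical
  let a : Equiv.Perm (Fin 3) := Equiv.swap 0 1
  let b : Equiv.Perm (Fin 3) := Equiv.swap 1 2
  have ha : a * a = 1 := by decide
  have hb : b * b = 1 := by decide
  let f : Sym2 V → Equiv.Perm (Fin 3) := fun e =>
    if e = s(p₁, c₁) ∨ e = s(c₁, c₃) ∨ e = s(p₃, c₃) then a
    else if e = s(p₂, c₂) ∨ e = s(c₂, c₄) ∨ e = s(p₄, c₄) then b else 1
  have hf : ∀ e, f e = (f e)⁻¹ := by
    intro e
    simp only [f]
    split_ifs <;> decide
  have hp : ∀ e ∈ [(p₁, c₁), (p₂, c₂), (p₃, c₃), (p₄, c₄)], e.1 ∉ R :=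
    fun e he => hwR e (hs.subset he)
  simp only [List.mem_cons, List.not_mem_nil, or_false, forall_eq_or_imp, forall_eq] at hp hR
  obtain ⟨hp₁, hp₂, hp₃, hp₄⟩ := hp
  obtain ⟨hR₁, hR₂, hR₃, hR₄⟩ := hR
  simp only [List.nodup_cons, List.mem_cons, List.not_mem_nil, or_false, not_or] at hc
  obtain ⟨⟨n12, n13, n14⟩, ⟨n23, n24⟩, n34, -⟩ := hc
  have hne : ∀ {x y : V}, x ∉ R → y ∈ R → x ≠ y := fun hx hy h => hx (h ▸ hy)
  have hμ := hB (fun u v => f s(u, v)) (fun u v => ?_) ?_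
  rotate_left
  · change f s(v, u) = (f s(u, v))⁻¹
    rw [Sym2.eq_swap]
    exact hf _
  rotate_left
  · rw [prod_map_eq_of_sublist hs hw] at hμ
    · have e1 : f s(p₁, c₁) = a := by simp [f]
      have e3 : f s(p₃, c₃) = a := by simp [f]
      have e2 : f s(p₂, c₂) = b := by
        have := hne hp₂ hR₁
        have := hne hp₂ hR₃
        have := hne hp₁ hR₂
        have := hne hp₃ hR₂
        simp [f]; grind
      have e4 : f s(p₄, c₄) = b := by
        have := hne hp₄ hR₁
        have := hne hp₄ hR₃
        have := hne hp₁ hR₄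
        have := hne hp₃ hR₄
        simp [f]; grind
      simp only [List.map_cons, List.map_nil, List.prod_cons, List.prod_nil, e1, e2, e3, e4] at hμ
      revert hμ
      decide
    · rintro ⟨x, y⟩ hx hx'
      have hxR := hwR _ hx
      have := hne hxR hR₁
      have := hne hxR hR₂
      have := hne hxR hR₃
      have := hne hxR hR₄
      simp only [f]
      rw [if_neg, if_neg] <;> simp at * <;> grind
  · intro v hv
    have k1 := hne hp₁ hv
    have k2 := hne hp₂ hv
    have k3 := hne hp₃ hv
    have k4 := hne hp₄ hv
    have key : ∀ {p q : V} {x : Equiv.Perm (Fin 3)}, G.Adj v p → G.Adj v q → p ≠ q → x * x = 1 →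
        f s(v, p) = x → f s(v, q) = x → (∀ u, u ≠ p → u ≠ q → f s(v, u) = 1) →
        ((rot v).map fun u => f s(v, u)).prod = 1 := fun hp hq hpq hx h1 h2 h3 =>
      prod_map_eq_one_of_pair (hrot.nodup v) _ ((hrot.mem_iff _ _).2 hp) ((hrot.mem_iff _ _).2 hq)
        hpq hx h1 h2 fun u _ => h3 u
    by_cases hv1 : v = c₁
    · subst hv1
      refine key h₁.symm h₁₃ (hne hp₁ hR₃) ha ?_ ?_ ?_
      · simp [f]
      · simp [f]
      · intro u hu hu'
        simp only [f]
        rw [if_neg, if_neg] <;> simp <;> grind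
    by_cases hv3 : v = c₃
    · subst hv3
      refine key h₃.symm h₁₃.symm (hne hp₃ hR₁) ha ?_ ?_ ?_
      · simp [f]
      · simp [f]
      · intro u hu hu'
        simp only [f]
        rw [if_neg, if_neg] <;> simp <;> grind
    by_cases hv2 : v = c₂
    · subst hv2
      refine key h₂.symm h₂₄ (hne hp₂ hR₄) hb ?_ ?_ ?_
      · simp [f]; grind
      · simp [f]; grind
      · intro u hu hu'
        simp only [f]
        rw [if_neg, if_neg] <;> simp <;> grind
    by_cases hv4 : v = c₄
    · subst hv4
      refine key h₄.symm h₂₄.symm (hne hp₄ hR₂) hb ?_ ?_ ?_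
      · simp [f]; grind
      · simp [f]; grind
      · intro u hu hu'
        simp only [f]
        rw [if_neg, if_neg] <;> simp <;> grind
    have : ((rot v).map fun u => f s(v, u)) = (rot v).map fun _ => 1 := by
      refine List.map_congr_left fun u _ => ?_
      simp only [f]
      rw [if_neg, if_neg] <;> simp <;> grind
    rw [this]
    simp

/-- Contracting a dart `(p, v)` of a word replaces it by the other darts at `v`. -/
theorem Bounds.contract {V : Type} {G : SimpleGraph V} {rot : V → List V}
    (hrot : IsRotation G rot) {R : Set V} {A B : List (V × V)} {p v : V}
    (hB : Bounds rot R (A ++ (p, v) :: B)) (hw : (A ++ (p, v) :: B).Nodup)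
    (hwR : ∀ e ∈ A ++ (p, v) :: B, e.1 ∉ R) (hv : v ∈ R) (hpv : G.Adj p v) :
    ∃ D : List V, D.Nodup ∧ (∀ u, u ∈ D ↔ G.Adj v u ∧ u ≠ p) ∧
      Bounds rot (R \ {v}) (A ++ D.map (fun u => (v, u)) ++ B) := by
  classical
  obtain ⟨R₁, R₂, hR⟩ := List.append_of_mem ((hrot.mem_iff v p).2 hpv.symm)
  have hnd := hrot.nodup v
  have hmem := hrot.mem_iff v
  rw [hR] at hnd hmem
  have hnd' : (p :: (R₂ ++ R₁)).Nodup := by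
    refine (List.Perm.nodup_iff ?_).1 hnd
    exact List.perm_append_comm
  rw [List.nodup_cons] at hnd'
  have hp : p ∉ R := hwR (p, v) (by simp)
  refine ⟨R₂ ++ R₁, hnd'.2, ?_, ?_⟩
  · intro u
    rw [← hmem]
    have := hnd'.1
    simp only [List.mem_append, List.mem_cons] at *
    grind
  intro μ hμ hμR
  have hpv' : p ≠ v := hpv.ne
  let q := ((R₂ ++ R₁).map (μ v)).prod
  let ν : V → V → Equiv.Perm (Fin 3) := fun x y =>
    if x = p ∧ y = v then q else if x = v ∧ y = p then q⁻¹ else μ x y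
  have hν1 : ∀ x y, ¬ (x = p ∧ y = v) → ¬ (x = v ∧ y = p) → ν x y = μ x y := by
    intro x y h1 h2
    simp [ν, h1, h2]
  have hνpv : ν p v = q := by simp [ν]
  have hνvp : ν v p = q⁻¹ := by simp [ν, hpv'.symm]
  have h := hB ν ?_ ?_
  · simp only [List.map_append, List.map_cons, List.prod_append, List.prod_cons, hνpv] at h
    have hA : A.map (fun e => ν e.1 e.2) = A.map fun e => μ e.1 e.2 := by
      refine List.map_congr_left fun e he => hν1 _ _ ?_ ?_
      · rintro ⟨h1, h2⟩
        have : (p, v) ∈ A := by rw [← h1, ← h2]; exact he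
        simp [List.nodup_append] at hw
        grind
      · rintro ⟨h1, -⟩
        exact hwR e (by simp [he]) (h1 ▸ hv)
    have hB' : B.map (fun e => ν e.1 e.2) = B.map fun e => μ e.1 e.2 := by
      refine List.map_congr_left fun e he => hν1 _ _ ?_ ?_
      · rintro ⟨h1, h2⟩
        have : (p, v) ∈ B := by rw [← h1, ← h2]; exact he
        simp [List.nodup_append] at hw
        grind
      · rintro ⟨h1, -⟩
        exact hwR e (by simp [he]) (h1 ▸ hv)
    rw [hA, hB'] at h
    rw [List.map_append, List.map_append, List.map_map, List.prod_append, List.prod_append, ← h]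
    simp only [mul_assoc]
    rfl
  · intro x y
    simp only [ν]
    have := hμ x y
    split_ifs <;> grind [inv_inv]
  · intro u hu
    by_cases huv : u = v
    · subst huv
      have h1 : R₁.map (ν u) = R₁.map (μ u) := by
        refine List.map_congr_left fun x hx => hν1 _ _ (by grind) ?_
        rintro ⟨-, rfl⟩
        exact hnd'.1 (by simp [hx])
      have h2 : R₂.map (ν u) = R₂.map (μ u) := by
        refine List.map_congr_left fun x hx => hν1 _ _ (by grind) ?_
        rintro ⟨-, rfl⟩
        exact hnd'.1 (by simp [hx])
      rw [hR, List.map_append, List.map_cons, List.prod_append, List.prod_cons, hνvp, h1, h2]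
      simp only [q, List.map_append, List.prod_append]
      group
    · rw [← hμR u ⟨hu, huv⟩]
      congr 1
      refine List.map_congr_left fun x _ => hν1 _ _ ?_ ?_
      · rintro ⟨rfl, -⟩
        exact hp hu
      · exact fun h => huv h.1

/-- The state of the peeling process after `k` vertices have been placed. The placed vertices are
those with `X v < k`, the others have `X v = k`; `ℓ` lists the unplaced neighbours of the placed
ones, and the key `κ v` is the path of child indices that leads to `v` in the tree of `par`. -/
structure PeelState {V : Type} [Fintype V] (G : SimpleGraph V) (rot : V → List V) (r : V)
    (k : ℕ) (X : V → ℕ) (par : V → V) (κ : V → List ℕ) (ℓ : List V) (w : List (V × V)) :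
    Prop where
  pos : 0 < k
  card_placed : (Finset.univ.filter fun v => X v < k).card = k
  le_time : ∀ v, X v ≤ k
  inj_placed : ∀ u v, X u < k → X u = X v → u = v
  root_time : X r = 0
  root_key : κ r = []
  open_nodup : ℓ.Nodup
  mem_open : ∀ v, v ∈ ℓ ↔ X v = k ∧ ∃ u, G.Adj u v ∧ X u < k
  placed_nbr : ∀ v, v ≠ r → X v < k → ∃ u, G.Adj u v ∧ X u < k
  par_spec : ∀ v, v ≠ r → (∃ u, G.Adj u v ∧ X u < k) →
    G.Adj (par v) v ∧ X (par v) < X v ∧ (∀ q, G.Adj q v → X (par v) ≤ X q) ∧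
      ∃ j, κ v = κ (par v) ++ [j]
  key_inj : ∀ u v, (u = r ∨ ∃ q, G.Adj q u ∧ X q < k) → (v = r ∨ ∃ q, G.Adj q v ∧ X q < k) →
    κ u = κ v → u = v
  open_sorted : ℓ.Pairwise (κ · < κ ·)
  consistent : ∀ u v z, X u < k → G.Adj u v → X u < X v → X u < X z → z ≠ v →
    (∃ q, G.Adj q z ∧ X q < X u) → (κ u < κ z ↔ κ v < κ z)
  word_nodup : w.Nodup
  word_placed : ∀ e ∈ w, X e.1 < k
  open_sublist : (ℓ.map fun c => (par c, c)).Sublist w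
  bounds : Bounds rot {v | X v = k} w

section
variable {V : Type} [Fintype V] {G : SimpleGraph V} {rot : V → List V} {r : V} {k : ℕ}
  {X : V → ℕ} {par : V → V} {κ : V → List ℕ} {ℓ : List V} {w : List (V × V)}

/-- Prefixes of keys of placed vertices are keys of placed vertices. -/
theorem PeelState.exists_of_prefix (h : PeelState G rot r k X par κ ℓ w) (v : V)
    (hv : X v < k) (p : List ℕ) (hp : p <+: κ v) : ∃ u, X u ≤ X v ∧ κ u = p := by
  induction hn : X v using Nat.strong_induction_on generalizing v with
  | _ n ih =>
    subst hn
    by_cases hvr : v = r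
    · subst hvr
      rw [h.root_key] at hp
      exact ⟨v, le_rfl, by rw [h.root_key]; exact (List.prefix_nil.1 hp).symm⟩
    · obtain ⟨-, hlt, -, j, hj⟩ := h.par_spec v hvr (h.placed_nbr v hvr hv)
      rw [hj, List.prefix_concat_iff] at hp
      rcases hp with rfl | hp
      · exact ⟨v, le_rfl, hj⟩
      · obtain ⟨u, hu, hu'⟩ := ih _ hlt _ (hlt.trans hv) hp rfl
        exact ⟨u, hu.trans hlt.le, hu'⟩

theorem PeelState.not_prefix (h : PeelState G rot r k X par κ ℓ w) {u z : V} (hu : u ∈ ℓ)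
    (hz : z ∈ ℓ) (huz : u ≠ z) : ¬ κ u <+: κ z := by
  intro hp
  have hr := h.root_time
  have hk := h.pos
  have hu' := (h.mem_open u).1 hu
  have hz' := (h.mem_open z).1 hz
  have hzr : z ≠ r := by rintro rfl; omega
  obtain ⟨-, hlt, -, j, hj⟩ := h.par_spec z hzr hz'.2
  rw [hj, List.prefix_concat_iff] at hp
  rcases hp with hp | hp
  · exact huz (h.key_inj _ _ (Or.inr hu'.2) (Or.inr hz'.2) (hp.trans hj.symm))
  · obtain ⟨y, hy, hy'⟩ := h.exists_of_prefix _ (hz'.1 ▸ hlt) _ hp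
    have : y = u := by
      refine h.key_inj _ _ ?_ (Or.inr hu'.2) hy'
      by_cases hyr : y = r
      · exact Or.inl hyr
      · exact Or.inr (h.placed_nbr y hyr (by omega))
    subst this
    omega

theorem PeelState.exists_next (hrot : IsRotation G rot) (h : PeelState G rot r k X par κ ℓ w)
    (hℓ : ℓ ≠ []) : ∃ v ∈ ℓ, ∀ u ∈ ℓ, G.Adj v u → ∀ z ∈ ℓ, z ≠ u → z ≠ v →
      (κ v < κ z ↔ κ u < κ z) := by
  classical
  have hr := h.root_time
  have hk := h.pos
  have hne : ∀ v ∈ ℓ, v ≠ r := by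
    rintro v hv rfl
    have := (h.mem_open v).1 hv
    omega
  have hpar : ∀ v ∈ ℓ, G.Adj (par v) v := fun v hv =>
    (h.par_spec v (hne v hv) ((h.mem_open v).1 hv).2).1
  have hinj : Set.InjOn κ (ℓ.toFinset : Set V) := by
    intro u hu v hv
    simp only [List.coe_toFinset, Set.mem_ofPred_eq] at hu hv
    exact h.key_inj u v (Or.inr ((h.mem_open u).1 hu).2) (Or.inr ((h.mem_open v).1 hv).2)
  have := exists_short_chords ℓ.toFinset (by simpa using hℓ) κ hinj G ?_
  · simpa using this
  · simp only [List.mem_toFinset]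
    intro a ha b hb c hc d hd hab hbc hcd hac hbd
    have hnd : [a, b, c, d].Pairwise (κ · < κ ·) := by
      simp only [List.pairwise_cons, List.mem_cons, List.not_mem_nil, or_false]
      grind
    have hnd' : [a, b, c, d].Nodup := hnd.imp fun h e => by rw [e] at h; exact lt_irrefl _ h
    have hmem : ∀ x ∈ [a, b, c, d], x ∈ ℓ := by simp [ha, hb, hc, hd]
    have : Std.Antisymm (fun x y => κ x < κ y) := ⟨fun _ _ h1 h2 => absurd h1 h2.not_gt⟩
    have hsub : [a, b, c, d].Sublist ℓ :=
      List.sublist_of_subperm_of_pairwise (List.subperm_of_subset hnd' hmem) hnd h.open_sorted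
    exact h.bounds.not_crossing hrot h.word_nodup
      (fun e he => (h.word_placed e he).ne) ((hsub.map fun c => (par c, c)).trans h.open_sublist)
      hnd' (fun x hx => ((h.mem_open x).1 (hmem x hx)).1) (hpar a ha) (hpar b hb) (hpar c hc)
      (hpar d hd) hac hbd

theorem PeelState.initial (hrot : IsRotation G rot)
    (hr : Bounds rot {v | v ≠ r} ((rot r).map fun u => (r, u))) :
    ∃ X par κ ℓ w, PeelState G rot r 1 X par κ ℓ w := by
  classical
  have hX : ∀ v, (if v = r then 0 else 1) < 1 ↔ v = r := fun v => by split_ifs <;> simp [*]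
  have hX' : ∀ v, (if v = r then 0 else 1) = 1 ↔ v ≠ r := fun v => by split_ifs <;> simp [*]
  refine ⟨fun v => if v = r then 0 else 1, fun _ => r,
    fun v => if v = r then [] else [(rot r).idxOf v], rot r, (rot r).map fun u => (r, u), ?_⟩
  have hself : r ∉ rot r := fun h => G.irrefl ((hrot.mem_iff _ _).1 h)
  constructor
  · exact one_pos
  · exact Finset.card_eq_one.2 ⟨r, by ext; simp [hX]⟩
  · intro v
    split_ifs <;> simp
  · intro u v hu huv
    grind
  · simp
  · simp
  · exact hrot.nodup r
  · intro v
    simp only [hX, hX', hrot.mem_iff]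
    constructor
    · exact fun h => ⟨h.ne', r, h, rfl⟩
    · rintro ⟨-, u, h, rfl⟩
      exact h
  · simp only [hX]
    intro v h1 h2
    exact absurd h2 h1
  · simp only [hX]
    rintro v hv ⟨u, huv, rfl⟩
    exact ⟨huv, by simp [hv], by simp, by simp [hv]⟩
  · simp only [hX]
    have : ∀ u, (u = r ∨ ∃ q, G.Adj q u ∧ q = r) → u = r ∨ u ∈ rot r := by
      rintro u (h | ⟨q, h, rfl⟩)
      · exact Or.inl h
      · exact Or.inr ((hrot.mem_iff _ _).2 h)
    intro u v hu hv huv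
    rcases this u hu with rfl | hu
    · by_contra hne
      simp [Ne.symm hne] at huv
    · have hur : u ≠ r := fun e => hself (e ▸ hu)
      rcases this v hv with rfl | hv
      · simp [hur] at huv
      · have hvr : v ≠ r := fun e => hself (e ▸ hv)
        simp only [hur, hvr, if_false, List.cons.injEq, and_true] at huv
        exact (List.idxOf_inj hu).1 huv
  · rw [List.pairwise_iff_getElem]
    intro i j hi hj hij
    have hne : ∀ u ∈ rot r, u ≠ r := by
      rintro u hu rfl
      exact hself hu
    have h1 := hne _ (List.getElem_mem hi)
    have h2 := hne _ (List.getElem_mem hj)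
    simp only [h1, h2, if_false, (hrot.nodup r).idxOf_getElem]
    simpa [List.cons_lt_cons_iff] using hij
  · rintro u v z hu - - - - ⟨q, -, hq⟩
    have := (hX u).1 hu
    simp [this] at hq
  · exact (hrot.nodup r).map fun a b h => by simpa using h
  · simp
  · exact List.Sublist.refl _
  · simpa only [hX'] using hr

theorem PeelState.next (hrot : IsRotation G rot) (h : PeelState G rot r k X par κ ℓ w)
    (hℓ : ℓ ≠ []) : ∃ X par κ ℓ w, PeelState G rot r (k + 1) X par κ ℓ w := by
  classical
  obtain ⟨v, hv, hshort⟩ := h.exists_next hrot hℓ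
  have hr := h.root_time
  have hk := h.pos
  obtain ⟨hvk, hvn⟩ := (h.mem_open v).1 hv
  have hvr : v ≠ r := by rintro rfl; omega
  obtain ⟨hpv, hpk, hpmin, j₀, hj₀⟩ := h.par_spec v hvr hvn
  obtain ⟨pre, post, hsplit⟩ := List.append_of_mem hv
  have hsub := h.open_sublist
  rw [hsplit, List.map_append, List.map_cons, List.append_sublist_iff] at hsub
  obtain ⟨w₁, w₂, hw₁₂, hpre, hsub⟩ := hsub
  rw [List.cons_sublist_iff] at hsub
  obtain ⟨w₃, w₄, hw₃₄, hmem, hpost⟩ := hsub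
  obtain ⟨w₅, w₆, hw₅₆⟩ := List.append_of_mem hmem
  obtain ⟨A, hA⟩ : ∃ A, A = w₁ ++ w₅ := ⟨_, rfl⟩
  obtain ⟨B, hBdef⟩ : ∃ B, B = w₆ ++ w₄ := ⟨_, rfl⟩
  have hw : w = A ++ (par v, v) :: B := by simp [hw₁₂, hw₃₄, hw₅₆, hA, hBdef]
  have hpreA : (pre.map fun c => (par c, c)).Sublist A :=
    hA ▸ hpre.trans (List.sublist_append_left _ _)
  have hpostB : (post.map fun c => (par c, c)).Sublist B :=
    hBdef ▸ hpost.trans (List.sublist_append_right _ _)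
  have hwn := h.word_nodup
  have hwp := h.word_placed
  have hbd := h.bounds
  rw [hw] at hwn hwp hbd
  obtain ⟨E, hE, hEmem, hEb⟩ := hbd.contract hrot hwn (fun e he => (hwp e he).ne) hvk hpv
  obtain ⟨D, hD⟩ : ∃ D, D = E.filter fun u => X u = k ∧ ∀ q, G.Adj q u → ¬ X q < k := ⟨_, rfl⟩
  have hDn : D.Nodup := hD ▸ hE.filter _
  have hDmem : ∀ u, u ∈ D ↔ G.Adj v u ∧ X u = k ∧ ∀ q, G.Adj q u → ¬ X q < k := by
    intro u
    simp only [hD, List.mem_filter, hEmem, decide_eq_true_eq]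
    constructor
    · tauto
    · rintro ⟨h1, h2, h3⟩
      exact ⟨⟨h1, by rintro rfl; omega⟩, h2, h3⟩
  have hDr : r ∉ D := fun hr' => by have := ((hDmem r).1 hr').2.1; omega
  have hDℓ : ∀ u ∈ ℓ, u ∉ D := by
    intro u hu hu'
    obtain ⟨q, hq, hq'⟩ := ((h.mem_open u).1 hu).2
    exact ((hDmem u).1 hu').2.2 q hq hq'
  have hDpl : ∀ u, X u < k → u ∉ D := fun u hu hu' => by have := ((hDmem u).1 hu').2.1; omega
  have hDd : ∀ u, (∃ q, G.Adj q u ∧ X q < k) → u ∉ D := by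
    rintro u ⟨q, hq, hq'⟩ hu
    exact ((hDmem u).1 hu).2.2 q hq hq'
  have hle := h.le_time
  let X' : V → ℕ := fun u => if X u = k ∧ u ≠ v then k + 1 else X u
  let par' : V → V := fun u => if u ∈ D then v else par u
  let κ' : V → List ℕ := fun u => if u ∈ D then κ v ++ [D.idxOf u] else κ u
  have hX'1 : ∀ u, X u < k → X' u = X u := fun u hu => if_neg fun h => by omega
  have hX'v : X' v = k := by simp [X', hvk]
  have hX'2 : ∀ u, X u = k → u ≠ v → X' u = k + 1 := fun u h1 h2 => if_pos ⟨h1, h2⟩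
  have hX'lt : ∀ u, X' u < k + 1 ↔ X u < k ∨ u = v := by
    intro u
    have := hle u
    simp only [X']
    split_ifs <;> grind
  have hX'eq : ∀ u, X' u = k + 1 ↔ X u = k ∧ u ≠ v := by
    intro u
    have := hle u
    simp only [X']
    split_ifs <;> grind
  have hX'ge : ∀ u, X u ≤ X' u := by
    intro u
    have := hle u
    simp only [X']
    split_ifs <;> omega
  have hX'k : ∀ u, k ≤ X' u ↔ X u = k := by
    intro u
    have := hle u
    simp only [X']
    split_ifs <;> grind
  have hκD : ∀ u ∈ D, κ' u = κ v ++ [D.idxOf u] := fun u hu => if_pos hu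
  have hκ : ∀ u, u ∉ D → κ' u = κ u := fun u hu => if_neg hu
  have hparD : ∀ u ∈ D, par' u = v := fun u hu => if_pos hu
  have hpar : ∀ u, u ∉ D → par' u = par u := fun u hu => if_neg hu
  have hvD : v ∉ D := hDℓ v hv
  have hdisc : ∀ u, u ≠ r → (∃ q, G.Adj q u ∧ X' q < k + 1) →
      (∃ q, G.Adj q u ∧ X q < k) ∨ u ∈ D := by
    rintro u hur ⟨q, hq, hq'⟩
    by_cases hold : ∃ q, G.Adj q u ∧ X q < k
    · exact Or.inl hold
    · right
      push Not at hold
      rcases (hX'lt q).1 hq' with hq' | rfl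
      · exact absurd (hold q hq) (by omega)
      · refine (hDmem u).2 ⟨hq, ?_, fun q hq => (hold q hq).not_gt⟩
        by_contra hne
        obtain ⟨y, hy, hy'⟩ := h.placed_nbr u hur (lt_of_le_of_ne (hle u) hne)
        exact absurd (hold y hy) (by omega)
  have hnp : ∀ z ∈ ℓ, z ≠ v → ¬ κ v <+: κ z := fun z hz hzv => h.not_prefix hv hz hzv.symm
  have hsorted := h.open_sorted
  rw [hsplit, List.pairwise_append, List.pairwise_cons] at hsorted
  have hlnd := h.open_nodup
  rw [hsplit] at hlnd
  have hpreℓ : ∀ u ∈ pre, u ∈ ℓ ∧ u ≠ v := fun u hu => by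
    rw [hsplit]
    refine ⟨by simp [hu], ?_⟩
    rintro rfl
    simp [List.nodup_append] at hlnd
    grind
  have hpostℓ : ∀ u ∈ post, u ∈ ℓ ∧ u ≠ v := fun u hu => by
    rw [hsplit]
    refine ⟨by simp [hu], ?_⟩
    rintro rfl
    simp [List.nodup_append] at hlnd
    grind
  have hℓiff : ∀ u, u ∈ ℓ ∧ u ≠ v ↔ u ∈ pre ∨ u ∈ post := by
    intro u
    constructor
    · rw [hsplit]
      simp only [List.mem_append, List.mem_cons]
      tauto
    · rintro (hu | hu)
      · exact hpreℓ u hu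
      · exact hpostℓ u hu
  refine ⟨X', par', κ', pre ++ D ++ post, A ++ E.map (fun u => (v, u)) ++ B, ?_⟩
  constructor
  · omega
  · have : (Finset.univ.filter fun u => X' u < k + 1) =
        insert v (Finset.univ.filter fun u => X u < k) := by
      ext u
      simp only [hX'lt, Finset.mem_filter, Finset.mem_univ, true_and, Finset.mem_insert]
      tauto
    rw [this, Finset.card_insert_of_notMem (by simp [hvk]), h.card_placed]
  · intro u
    have := hle u
    simp only [X']
    split_ifs <;> omega
  · intro a b ha hab
    have hb : X' b < k + 1 := hab ▸ ha
    rcases (hX'lt a).1 ha with ha' | rfl <;> rcases (hX'lt b).1 hb with hb' | rfl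
    · rw [hX'1 a ha', hX'1 b hb'] at hab
      exact h.inj_placed a b ha' hab
    · rw [hX'1 a ha', hX'v] at hab
      omega
    · rw [hX'1 b hb', hX'v] at hab
      omega
    · rfl
  · rw [hX'1 r (by omega), hr]
  · rw [hκ r hDr, h.root_key]
  · have hdis : ∀ u ∈ D, u ∉ pre ∧ u ∉ post := fun u hu =>
      ⟨fun hu' => hDℓ u (hpreℓ u hu').1 hu, fun hu' => hDℓ u (hpostℓ u hu').1 hu⟩
    exact nodup_replace hlnd hDn hdis
  · intro u
    have h1 : u ∈ pre ++ D ++ post ↔ (u ∈ ℓ ∧ u ≠ v) ∨ u ∈ D := by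
      rw [hℓiff]
      simp only [List.mem_append]
      tauto
    rw [h1, hX'eq, h.mem_open, hDmem]
    simp only [hX'lt]
    constructor
    · rintro (⟨⟨h1, q, h2, h3⟩, h4⟩ | ⟨h1, h2, h3⟩)
      · exact ⟨⟨h1, h4⟩, q, h2, Or.inl h3⟩
      · exact ⟨⟨h2, h1.ne'⟩, v, h1, Or.inr rfl⟩
    · rintro ⟨⟨h5, h2⟩, q, h3, h4⟩
      by_cases hold : ∃ q, G.Adj q u ∧ X q < k
      · exact Or.inl ⟨⟨h5, hold⟩, h2⟩
      · right
        push Not at hold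
        rcases h4 with h4 | rfl
        · exact absurd (hold q h3) (by omega)
        · exact ⟨h3, h5, fun q hq => (hold q hq).not_gt⟩
  · intro u hur hu
    rcases (hX'lt u).1 hu with hu | rfl
    · obtain ⟨q, hq, hq'⟩ := h.placed_nbr u hur hu
      exact ⟨q, hq, (hX'lt q).2 (Or.inl hq')⟩
    · obtain ⟨q, hq, hq'⟩ := hvn
      exact ⟨q, hq, (hX'lt q).2 (Or.inl hq')⟩
  · intro u hur hu
    rcases hdisc u hur hu with hold | huD
    · obtain ⟨h1, h2, h3, j, h4⟩ := h.par_spec u hur hold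
      have huD := hDd u hold
      have hpu : X (par u) < k := h2.trans_le (hle u)
      rw [hpar u huD, hκ u huD, hκ _ (hDpl _ hpu), hX'1 _ hpu]
      exact ⟨h1, h2.trans_le (hX'ge u), fun q hq => (h3 q hq).trans (hX'ge q), j, h4⟩
    · obtain ⟨h1, h2, h3⟩ := (hDmem u).1 huD
      rw [hparD u huD, hκD u huD, hκ v hvD, hX'v, hX'2 u h2 h1.ne']
      refine ⟨h1, by omega, fun q hq => ?_, _, rfl⟩
      have := h3 q hq
      have := hle q
      exact (hX'k q).2 (by omega)
  · have hmix : ∀ a b, a ∈ D → (b = r ∨ ∃ q, G.Adj q b ∧ X q < k) → κ' a ≠ κ' b := by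
      intro a b ha hb hab
      have hbD : b ∉ D := by
        rcases hb with rfl | hb
        · exact hDr
        · exact hDd b hb
      rw [hκD a ha, hκ b hbD] at hab
      by_cases hbr : b = r
      · rw [hbr, h.root_key] at hab
        simp at hab
      · obtain ⟨h1, h2, -, j, h4⟩ := h.par_spec b hbr (hb.resolve_left hbr)
        rw [h4] at hab
        have hpb : X (par b) < k := h2.trans_le (hle b)
        have := h.key_inj v (par b) (Or.inr hvn) ?_ (List.append_inj' hab rfl).1
        · rw [← this] at hpb
          omega
        · by_cases hbr' : par b = r
          · exact Or.inl hbr'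
          · exact Or.inr (h.placed_nbr _ hbr' hpb)
    have hcase : ∀ a, (a = r ∨ ∃ q, G.Adj q a ∧ X' q < k + 1) →
        (a = r ∨ ∃ q, G.Adj q a ∧ X q < k) ∨ a ∈ D := by
      intro a ha
      by_cases har : a = r
      · exact Or.inl (Or.inl har)
      · rcases hdisc a har (ha.resolve_left har) with h | h
        · exact Or.inl (Or.inr h)
        · exact Or.inr h
    have hnot : ∀ a, (a = r ∨ ∃ q, G.Adj q a ∧ X q < k) → a ∉ D := by
      rintro a (rfl | ha)
      · exact hDr
      · exact hDd a ha
    intro a b ha hb hab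
    rcases hcase a ha with ha | ha <;> rcases hcase b hb with hb | hb
    · rw [hκ a (hnot a ha), hκ b (hnot b hb)] at hab
      exact h.key_inj a b ha hb hab
    · exact absurd hab.symm (hmix b a hb ha)
    · exact absurd hab (hmix a b ha hb)
    · rw [hκD a ha, hκD b hb] at hab
      have := (List.append_inj' hab rfl).2
      exact (List.idxOf_inj ha).1 (by simpa using this)
  · obtain ⟨hs1, ⟨hs2, hs3⟩, hs4⟩ := hsorted
    have hpreκ : ∀ u ∈ pre, κ' u = κ u := fun u hu => hκ u (hDℓ u (hpreℓ u hu).1)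
    have hpostκ : ∀ u ∈ post, κ' u = κ u := fun u hu => hκ u (hDℓ u (hpostℓ u hu).1)
    rw [List.pairwise_append, List.pairwise_append]
    refine ⟨⟨?_, ?_, ?_⟩, ?_, ?_⟩
    · refine hs1.imp_of_mem fun ha hb hab => ?_
      rwa [hpreκ _ ha, hpreκ _ hb]
    · rw [List.pairwise_iff_getElem]
      intro i j hi hj hij
      rw [hκD _ (List.getElem_mem hi), hκD _ (List.getElem_mem hj), hDn.idxOf_getElem,
        hDn.idxOf_getElem]
      exact append_lt_append_self _ hij
    · intro a ha b hb
      rw [hpreκ a ha, hκD b hb]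
      exact (hs4 a ha v (by simp)).trans_le (le_append_self _ _)
    · refine hs3.imp_of_mem fun ha hb hab => ?_
      rwa [hpostκ _ ha, hpostκ _ hb]
    · intro a ha b hb
      rw [hpostκ b hb]
      rcases List.mem_append.1 ha with ha | ha
      · rw [hpreκ a ha]
        exact hs4 a ha b (by simp [hb])
      · rw [hκD a ha]
        exact append_lt_of_lt_of_not_prefix _ (hs2 b hb) (hnp b (hpostℓ b hb).1 (hpostℓ b hb).2)
  · rintro a b z ha hab hXab hXaz hzb ⟨q, hqz, hqa⟩
    rcases (hX'lt a).1 ha with ha | rfl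
    · have hlt : ∀ y, X' a < X' y → X a < X y := by
        intro y hy
        rw [hX'1 a ha] at hy
        have := hle y
        simp only [X'] at hy
        split_ifs at hy <;> omega
      rw [hX'1 a ha] at hqa
      have hqa' : X q < X a := (hX'ge q).trans_lt hqa
      rw [hκ a (hDpl a ha), hκ b (hDd b ⟨a, hab, ha⟩), hκ z (hDd z ⟨q, hqz, by omega⟩)]
      exact h.consistent a b z ha hab (hlt b hXab) (hlt z hXaz) hzb ⟨q, hqz, hqa'⟩
    · rw [hX'v] at hXab hXaz hqa
      have hqk : X q < k := (hX'ge q).trans_lt hqa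
      have hb : X b = k ∧ b ≠ a := (hX'eq b).1 (by have := (hX'lt b).1.mt; grind)
      have hz : X z = k ∧ z ≠ a := (hX'eq z).1 (by have := (hX'lt z).1.mt; grind)
      have hzℓ : z ∈ ℓ := (h.mem_open z).2 ⟨hz.1, q, hqz, hqk⟩
      rw [hκ a hvD, hκ z (hDℓ z hzℓ)]
      by_cases hbD : b ∈ D
      · rw [hκD b hbD]
        exact lt_iff_append_lt _ (hnp z hzℓ hz.2)
      · rw [hκ b hbD]
        refine hshort b ?_ hab z hzℓ hzb hz.2
        refine (h.mem_open b).2 ⟨hb.1, ?_⟩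
        by_contra! hcon
        exact hbD ((hDmem b).2 ⟨hab, hb.1, fun q hq => (hcon q hq).not_gt⟩)
  · refine nodup_replace hwn (hE.map fun a b h => by simpa using h) fun e he => ?_
    obtain ⟨u, -, rfl⟩ := List.mem_map.1 he
    have := fun hmem => hwp (v, u) hmem
    simp only [hvk, lt_irrefl, imp_false, List.mem_append, List.mem_cons, not_or] at this
    exact ⟨this.1, this.2.2⟩
  · intro e he
    rw [hX'lt]
    simp only [List.mem_append, List.mem_map] at he
    rcases he with (he | ⟨u, -, rfl⟩) | he
    · exact Or.inl (hwp e (by simp [he]))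
    · exact Or.inr rfl
    · exact Or.inl (hwp e (by simp [he]))
  · rw [List.map_append, List.map_append]
    refine (List.Sublist.append ?_ ?_).append ?_
    · convert hpreA using 1
      refine List.map_congr_left fun u hu => ?_
      rw [hpar u (hDℓ u (hpreℓ u hu).1)]
    · have : D.map (fun c => (par' c, c)) = D.map fun u => (v, u) :=
        List.map_congr_left fun u hu => by rw [hparD u hu]
      rw [this, hD]
      exact List.filter_sublist.map _
    · convert hpostB using 1
      refine List.map_congr_left fun u hu => ?_
      rw [hpar u (hDℓ u (hpostℓ u hu).1)]
  · have : {u | X' u = k + 1} = {u | X u = k} \ {v} := by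
      ext u
      simp [hX'eq]
    rw [this]
    exact hEb

/-- Every connected planar graph can be peeled off completely. -/
theorem exists_complete_peelState (hrot : IsRotation G rot) (hG : G.Connected)
    (hr : Bounds rot {v | v ≠ r} ((rot r).map fun u => (r, u))) :
    ∃ X par κ ℓ w, PeelState G rot r (Fintype.card V) X par κ ℓ w := by
  have := hG.nonempty
  have key : ∀ k, 1 ≤ k → k ≤ Fintype.card V →
      ∃ X par κ ℓ w, PeelState G rot r k X par κ ℓ w := by
    intro k hk
    induction k, hk using Nat.le_induction with
    | base => exact fun _ => PeelState.initial hrot hr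
    | succ k hk ih =>
      intro hkn
      obtain ⟨X, par, κ, ℓ, w, h⟩ := ih (by omega)
      refine h.next hrot ?_
      rintro rfl
      have hall : ∀ v, X v < k := by
        intro v
        have hw := hG.preconnected r v
        obtain ⟨p⟩ := hw
        by_contra hv
        obtain ⟨d, -, hd1, hd2⟩ := p.exists_boundary_dart {v | X v < k}
          (by have := h.root_time; simp only [Set.mem_ofPred_eq]; omega) hv
        have hd3 := h.le_time d.snd
        simp only [Set.mem_ofPred_eq] at hd1 hd2
        exact absurd ((h.mem_open d.snd).2 ⟨by omega, d.fst, d.adj, hd1⟩) List.not_mem_nil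
      have := h.card_placed
      rw [Finset.filter_true_of_mem fun v _ => hall v, Finset.card_univ] at this
      omega
  exact key _ Fintype.card_pos le_rfl

end
end Peeling

section Drawing

/-- The combinatorial data of a drawing that places `v` at abscissa `X v` and at height `Y v`, in
which the tree edge from `par v` to `v` has slope `σ v`. -/
structure Layout {V : Type} (G : SimpleGraph V) (r : V) (X : V → ℕ) (par : V → V) (σ Y : V → ℝ) :
    Prop where
  time_inj : Function.Injective X
  root_time : X r = 0
  slope_inj : Function.Injective σ
  par_adj : ∀ v, v ≠ r → G.Adj (par v) v
  par_lt : ∀ v, v ≠ r → X (par v) < X v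
  par_le : ∀ v, v ≠ r → ∀ q, G.Adj q v → X (par v) ≤ X q
  consistent : ∀ u v z q, G.Adj u v → X u < X v → X u < X z → z ≠ v → G.Adj q z → X q < X u →
    (σ u < σ z ↔ σ v < σ z)
  height : ∀ v, v ≠ r → Y v = Y (par v) + σ v * (X v - X (par v))

variable {V : Type} {G : SimpleGraph V} {r : V} {X : V → ℕ} {par : V → V} {σ Y : V → ℝ}

theorem Layout.neg (h : Layout G r X par σ Y) : Layout G r X par (-σ) (-Y) where
  __ := h
  slope_inj := neg_injective.comp h.slope_inj
  consistent u v z q huv hXuv hXuz hzv hqz hqu := by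
    have h1 := h.slope_inj.ne hzv
    have h2 : σ u ≠ σ z := h.slope_inj.ne (by rintro rfl; omega)
    have h3 := h.consistent u v z q huv hXuv hXuz hzv hqz hqu
    simp only [Pi.neg_apply, neg_lt_neg_iff]
    grind
  height v hv := by
    simp only [Pi.neg_apply, h.height v hv]
    ring

theorem Layout.ne_root (h : Layout G r X par σ Y) {v : V} (hv : 0 < X v) : v ≠ r := by
  rintro rfl
  exact hv.ne' h.root_time

theorem Layout.tree_edge_lt (h : Layout G r X par σ Y) (a b : V) (ha : a ≠ r) (hb : b ≠ r)
    (t : ℝ) (hat : X (par a) < t) (hbt : X (par b) < t) (hta : t ≤ X a) (htb : t ≤ X b)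
    (hab : σ a < σ b) :
    Y (par a) + σ a * (t - X (par a)) < Y (par b) + σ b * (t - X (par b)) := by
  induction hs : max (X (par a)) (X (par b)) using Nat.strong_induction_on
    generalizing a b t with
  | _ s ih =>
    rcases lt_trichotomy (X (par a)) (X (par b)) with hlt | heq | hlt
    · rw [max_eq_right hlt.le] at hs
      have hur := h.ne_root (Nat.zero_lt_of_lt hlt)
      have hbpa : X (par b) < X a := by exact_mod_cast hbt.trans_le hta
      have hne : par b ≠ a := by
        intro e
        rw [e] at hbpa
        exact lt_irrefl _ hbpa
      have hσ := h.consistent _ b a (par a) (h.par_adj b hb) (h.par_lt b hb) hbpa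
        (by rintro rfl; exact lt_irrefl _ hab) (h.par_adj a ha) hlt
      have hσ' : σ a < σ (par b) :=
        lt_of_le_of_ne (not_lt.1 fun h' => hab.not_gt (hσ.1 h')) (h.slope_inj.ne hne.symm)
      have hpp := h.par_lt _ hur
      have := ih _ (by rw [← hs]; exact max_lt hlt hpp) a (par b) ha hur (X (par b))
        (by exact_mod_cast hlt) (by exact_mod_cast hpp) (by exact_mod_cast hbpa.le) le_rfl hσ' rfl
      rw [← h.height _ hur] at this
      nlinarith
    · rw [h.time_inj heq] at hat ⊢
      nlinarith
    · rw [max_eq_left hlt.le] at hs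
      have hur := h.ne_root (Nat.zero_lt_of_lt hlt)
      have hapb : X (par a) < X b := by exact_mod_cast hat.trans_le htb
      have hσ := (h.consistent _ a b (par b) (h.par_adj a ha) (h.par_lt a ha) hapb
        (by rintro rfl; exact lt_irrefl _ hab) (h.par_adj b hb) hlt).2 hab
      have hpp := h.par_lt _ hur
      have := ih _ (by rw [← hs]; exact max_lt hpp hlt) (par a) b hur hb (X (par a))
        (by exact_mod_cast hpp) (by exact_mod_cast hlt) le_rfl (by exact_mod_cast hapb.le) hσ rfl
      rw [← h.height _ hur] at this
      nlinarith

theorem Layout.lt_edge (h : Layout G r X par σ Y) {u v : V} (huv : G.Adj u v) (m : ℝ)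
    (hm : Y v = Y u + m * (X v - X u)) (z : V) (huz : X u < X z) (hzv : X z < X v)
    (hσ : σ z < σ v) : Y z < Y u + m * (X z - X u) := by
  have hvr := h.ne_root (Nat.zero_lt_of_lt hzv)
  have key : ∀ z, X u < X z → X z < X v → σ z < σ v → X (par v) < X z →
      Y z < Y (par v) + σ v * (X z - X (par v)) := by
    intro z huz hzv hσ hpz
    have hzr := h.ne_root (Nat.zero_lt_of_lt huz)
    have := h.tree_edge_lt z v hzr hvr (X z) (by exact_mod_cast h.par_lt z hzr)
      (by exact_mod_cast hpz) le_rfl (by exact_mod_cast hzv.le) hσ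
    rwa [← h.height z hzr] at this
  have hple := h.par_le v hvr u huv
  have hhv := h.height v hvr
  have huv' : (X u : ℝ) < X v := by exact_mod_cast huz.trans hzv
  have huz' : (X u : ℝ) < X z := by exact_mod_cast huz
  have hzv' : (X z : ℝ) < X v := by exact_mod_cast hzv
  rcases hple.eq_or_lt with heq | hlt
  · have := key z huz hzv hσ (by omega)
    rw [h.time_inj heq] at this hhv
    have : m = σ v := by
      have hne : (X v : ℝ) - X u ≠ 0 := by linarith
      exact mul_right_cancel₀ hne (by linarith)
    rw [this]
    linarith
  have hur := h.ne_root (Nat.zero_lt_of_lt hlt)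
  have hne : u ≠ v := huv.ne
  have hlt' : (X (par v) : ℝ) < X u := by exact_mod_cast hlt
  rcases lt_or_gt_of_ne (h.slope_inj.ne hne) with huσ | huσ
  · have h1 := h.tree_edge_lt u v hur hvr (X u) (by exact_mod_cast h.par_lt u hur) hlt' le_rfl
      huv'.le huσ
    rw [← h.height u hur] at h1
    have hmσ : σ v < m := by
      by_contra! hcon
      nlinarith
    clear key
    induction hn : X z using Nat.strong_induction_on generalizing z with
    | _ n ih =>
      subst hn
      have hzr := h.ne_root (Nat.zero_lt_of_lt huz)
      have hpz := h.par_lt z hzr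
      have hpz' : (X (par z) : ℝ) < X z := by exact_mod_cast hpz
      have hhz := h.height z hzr
      have hzv'' : z ≠ v := by rintro rfl; exact lt_irrefl _ hσ
      rcases lt_trichotomy (X u) (X (par z)) with hup | hup | hup
      · have hσ' := (h.consistent (par z) z v (par v) (h.par_adj z hzr) hpz (hpz.trans hzv)
          hzv''.symm (h.par_adj v hvr) (hlt.trans hup)).2 hσ
        have := ih _ hpz (par z) hup (hpz.trans hzv) hσ' (by exact_mod_cast hup)
          (by exact_mod_cast hpz.trans hzv) rfl
        nlinarith
      · rw [← h.time_inj hup] at hhz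
        nlinarith
      · have hσ' := h.consistent u v z (par z) huv (huz.trans hzv) huz hzv'' (h.par_adj z hzr) hup
        have hzu : z ≠ u := by rintro rfl; exact lt_irrefl _ huz
        have hσ'' : σ z < σ u :=
          lt_of_le_of_ne (not_lt.1 fun h' => hσ.not_gt (hσ'.1 h')) (h.slope_inj.ne hzu)
        have h2 := h.tree_edge_lt z u hzr hur (X u) (by exact_mod_cast hup)
          (by exact_mod_cast h.par_lt u hur) huz'.le le_rfl hσ''
        rw [← h.height u hur] at h2
        nlinarith
  · have h1 := h.neg.tree_edge_lt u v hur hvr (X u) (by exact_mod_cast h.par_lt u hur) hlt' le_rfl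
      huv'.le (neg_lt_neg huσ)
    rw [← h.neg.height u hur] at h1
    simp only [Pi.neg_apply] at h1
    have := key z huz hzv hσ (by omega)
    have hmσ : m < σ v := by
      by_contra! hcon
      nlinarith
    nlinarith

theorem Layout.edge_lt (h : Layout G r X par σ Y) {u v : V} (huv : G.Adj u v) (m : ℝ)
    (hm : Y v = Y u + m * (X v - X u)) (z : V) (huz : X u < X z) (hzv : X z < X v)
    (hσ : σ v < σ z) : Y u + m * (X z - X u) < Y z := by
  have := h.neg.lt_edge huv (-m) (by simp only [Pi.neg_apply, hm]; ring) z huz hzv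
    (neg_lt_neg hσ)
  simp only [Pi.neg_apply] at this
  linarith

theorem affine_lt {c m x c' m' x' a b t : ℝ} (ha : c + m * (a - x) < c' + m' * (a - x'))
    (hb : c + m * (b - x) < c' + m' * (b - x')) (hat : a ≤ t) (htb : t ≤ b) :
    c + m * (t - x) < c' + m' * (t - x') := by
  rcases le_total m m' with hm | hm <;> nlinarith

theorem Layout.exists_common_end (h : Layout G r X par σ Y) {u v u' v' : V} (huv : G.Adj u v)
    (huv' : G.Adj u' v') (hX : X u < X v) (hX' : X u' < X v') (hne : (u, v) ≠ (u', v'))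
    (m m' : ℝ) (hm : Y v = Y u + m * (X v - X u)) (hm' : Y v' = Y u' + m' * (X v' - X u'))
    (t : ℝ) (h1 : X u ≤ t) (h2 : t ≤ X v) (h1' : X u' ≤ t) (h2' : t ≤ X v')
    (heq : Y u + m * (t - X u) = Y u' + m' * (t - X u')) :
    ∃ x, (x = u ∨ x = v) ∧ (x = u' ∨ x = v') ∧ t = X x := by
  wlog hle : X v ≤ X v' generalizing u v u' v' m m'
  · obtain ⟨x, hx, hx', hxt⟩ := this huv' huv hX' hX hne.symm m' m hm' hm h1' h2' h1 h2 heq.symm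
      (by omega)
    exact ⟨x, hx', hx, hxt⟩
  rcases hle.eq_or_lt with hvv | hvv
  · obtain rfl := h.time_inj hvv
    refine ⟨v, Or.inr rfl, Or.inr rfl, ?_⟩
    clear hle hvv
    wlog hu : X u < X u' generalizing u u' m m'
    · have huu : X u' ≠ X u := fun e => hne (by rw [h.time_inj e])
      apply this (u := u') (u' := u) (m := m') (m' := m) <;>
        first | assumption | exact hne.symm | exact heq.symm | omega
    by_contra hcon
    have hlt : t < X v := lt_of_le_of_ne h2 hcon
    have huv2 : (X u' : ℝ) < X v := by exact_mod_cast hX'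
    have hmm : m = m' := by
      have hne : (X v : ℝ) - t ≠ 0 := by linarith
      exact mul_right_cancel₀ hne (by linarith)
    subst hmm
    rcases lt_or_gt_of_ne (h.slope_inj.ne huv'.ne) with hσ | hσ
    · have := h.lt_edge huv m hm u' hu hX' hσ
      linarith
    · have := h.edge_lt huv m hm u' hu hX' hσ
      linarith
  · have hvv' : (X v : ℝ) < X v' := by exact_mod_cast hvv
    have hnv : v ≠ v' := by rintro rfl; exact lt_irrefl _ hvv
    by_cases hvu : X v ≤ X u'
    · have hvu' : (X v : ℝ) ≤ X u' := by exact_mod_cast hvu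
      have : (X v : ℝ) = X u' := by linarith
      have : v = u' := h.time_inj (by exact_mod_cast this)
      exact ⟨v, Or.inr rfl, Or.inl this, by linarith⟩
    have hvu' : (X u' : ℝ) < X v := by exact_mod_cast not_le.1 hvu
    have hXr : (X u : ℝ) < X v := by exact_mod_cast hX
    have hXr' : (X u' : ℝ) < X v' := by exact_mod_cast hX'
    have hv1 := h.lt_edge huv' m' hm' v (not_le.1 hvu) hvv
    have hv2 := h.edge_lt huv' m' hm' v (not_le.1 hvu) hvv
    have hσv := h.slope_inj.ne hnv
    rcases lt_trichotomy (X u) (X u') with hu | hu | hu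
    · exfalso
      have hur : (X u : ℝ) < X u' := by exact_mod_cast hu
      have hne' : u' ≠ v := by rintro rfl; exact hvu le_rfl
      have hσ := h.consistent u' v' v u huv' hX' (not_le.1 hvu) hnv huv hu
      have hσu := h.slope_inj.ne hne'
      rcases lt_or_gt_of_ne hσv with hs | hs
      · have h3 := hv1 hs
        have h4 := h.edge_lt huv m hm u' hu (not_le.1 hvu)
          (lt_of_le_of_ne (not_lt.1 fun h' => hs.not_gt (hσ.1 h')) hσu.symm)
        rw [hm] at h3
        exact (affine_lt (by simpa using h4) h3 h1' h2).ne heq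
      · have h3 := hv2 hs
        have h4 := h.lt_edge huv m hm u' hu (not_le.1 hvu) (hσ.2 hs)
        rw [hm] at h3
        exact (affine_lt (by simpa using h4) h3 h1' h2).ne' heq
    · obtain rfl := h.time_inj hu
      refine ⟨u, Or.inl rfl, Or.inl rfl, ?_⟩
      by_contra hcon
      have hlt : t - X u ≠ 0 := sub_ne_zero.2 hcon
      have : m = m' := mul_right_cancel₀ hlt (by linarith)
      subst this
      rcases lt_or_gt_of_ne hσv with hs | hs
      · have := hv1 hs
        linarith
      · have := hv2 hs
        linarith
    · exfalso
      have hur : (X u' : ℝ) < X u := by exact_mod_cast hu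
      have hne' : u ≠ v' := by rintro rfl; omega
      have hσ := h.consistent u v v' u' huv hX (by omega) hnv.symm huv' hu
      have hσu := h.slope_inj.ne hne'
      rcases lt_or_gt_of_ne hσv with hs | hs
      · have h3 := hv1 hs
        have h4 := h.lt_edge huv' m' hm' u hu (by omega) (hσ.2 hs)
        rw [hm] at h3
        exact (affine_lt (by simpa using h4) h3 h1 h2).ne heq
      · have h3 := hv2 hs
        have h4 := h.edge_lt huv' m' hm' u hu (by omega)
          (lt_of_le_of_ne (not_lt.1 fun h' => hs.not_gt (hσ.1 h')) hσu.symm)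
        rw [hm] at h3
        exact (affine_lt (by simpa using h4) h3 h1 h2).ne' heq

theorem exists_eq_of_mem_segment {p q z : ℝ × ℝ} (hpq : p.1 < q.1) (hz : z ∈ segment ℝ p q)
    {m : ℝ} (hm : q.2 = p.2 + m * (q.1 - p.1)) :
    p.1 ≤ z.1 ∧ z.1 ≤ q.1 ∧ z.2 = p.2 + m * (z.1 - p.1) := by
  obtain ⟨a, b, ha, hb, hab, rfl⟩ := hz
  obtain rfl : a = 1 - b := by linarith
  simp only [Prod.fst_add, Prod.snd_add, Prod.smul_fst, Prod.smul_snd, smul_eq_mul, hm]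
  refine ⟨by nlinarith, by nlinarith, by ring⟩

theorem Layout.isPlanarDrawing (h : Layout G r X par σ Y) (hG : G.Connected) :
    IsPlanarDrawing G fun v => ((X v : ℝ), Y v) := by
  have hinj : Function.Injective fun v => ((X v : ℝ), Y v) := by
    intro u v huv
    have : (X u : ℝ) = X v := congrArg Prod.fst huv
    exact h.time_inj (by exact_mod_cast this)
  have hcross : ∀ a b c d : V, G.Adj a b → G.Adj c d → s(a, b) ≠ s(c, d) →
      ∀ p : ℝ × ℝ, p ∈ segment ℝ ((X a : ℝ), Y a) ((X b : ℝ), Y b) →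
      p ∈ segment ℝ ((X c : ℝ), Y c) ((X d : ℝ), Y d) →
      ∃ x : V, (x = a ∨ x = b) ∧ (x = c ∨ x = d) ∧ p = ((X x : ℝ), Y x) := by
    intro a b c d hab hcd hne p hp hp'
    wlog hXab : X a < X b generalizing a b
    · have hXne : X a ≠ X b := h.time_inj.ne hab.ne
      obtain ⟨x, hx, hx'⟩ := this b a hab.symm (by rwa [Sym2.eq_swap])
        (by rwa [segment_symm]) (by omega)
      exact ⟨x, hx.symm, hx'⟩
    wlog hXcd : X c < X d generalizing c d
    · have hXne : X c ≠ X d := h.time_inj.ne hcd.ne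
      obtain ⟨x, hx, hx', hx''⟩ := this d c hcd.symm (by rwa [segment_symm])
        (by rwa [Sym2.eq_swap (a := d)]) (by omega)
      exact ⟨x, hx, hx'.symm, hx''⟩
    have hXab' : (X a : ℝ) < X b := by exact_mod_cast hXab
    have hXcd' : (X c : ℝ) < X d := by exact_mod_cast hXcd
    obtain ⟨m, hm⟩ : ∃ m, Y b = Y a + m * (X b - X a) :=
      ⟨(Y b - Y a) / (X b - X a), by field_simp [sub_ne_zero.2 hXab'.ne']; ring⟩
    obtain ⟨m', hm'⟩ : ∃ m, Y d = Y c + m * (X d - X c) :=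
      ⟨(Y d - Y c) / (X d - X c), by field_simp [sub_ne_zero.2 hXcd'.ne']; ring⟩
    obtain ⟨h1, h2, h3⟩ := exists_eq_of_mem_segment hXab' hp hm
    obtain ⟨h1', h2', h3'⟩ := exists_eq_of_mem_segment hXcd' hp' hm'
    obtain ⟨x, hx, hx', hxp⟩ := h.exists_common_end hab hcd hXab hXcd
      (fun e => hne (by rw [(Prod.mk.inj e).1, (Prod.mk.inj e).2])) m m' hm hm' p.1 h1 h2 h1' h2'
      (h3.symm.trans h3')
    refine ⟨x, hx, hx', Prod.ext hxp ?_⟩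
    rw [h3, hxp]
    rcases hx with rfl | rfl
    · simp
    · exact hm.symm
  refine ⟨hinj, hcross, ?_⟩
  intro a b c hab hca hcb hc
  have : Nontrivial V := ⟨a, c, hca.symm⟩
  obtain ⟨d, hd⟩ := hG.preconnected.exists_adj_of_nontrivial c
  obtain ⟨x, hx, -, hx'⟩ := hcross a b c d hab hd
    (by rw [Ne, Sym2.eq_iff]; tauto) _ (openSegment_subset_segment _ _ _ hc)
    (left_mem_segment _ _ _)
  obtain rfl := hinj hx'
  tauto

end Drawing

section Tree

/-- The graph in which every `v ≠ r` is joined to its parent `par v`. -/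
def parentGraph {V : Type} (r : V) (par : V → V) : SimpleGraph V :=
  SimpleGraph.fromRel fun u v => v ≠ r ∧ u = par v

variable {V : Type} {G : SimpleGraph V} {r : V} {X : V → ℕ} {par : V → V} {σ Y : V → ℝ}

theorem Layout.parentGraph_adj (h : Layout G r X par σ Y) {v : V} (hv : v ≠ r) :
    (parentGraph r par).Adj (par v) v :=
  (SimpleGraph.fromRel_adj _ _ _).2 ⟨(h.par_adj v hv).ne, Or.inl ⟨hv, rfl⟩⟩

theorem Layout.parentGraph_le (h : Layout G r X par σ Y) : parentGraph r par ≤ G := by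
  intro u v huv
  rcases ((SimpleGraph.fromRel_adj _ _ _).1 huv).2 with ⟨hv, rfl⟩ | ⟨hv, rfl⟩
  · exact h.par_adj _ hv
  · exact (h.par_adj _ hv).symm

theorem Layout.induction (h : Layout G r X par σ Y) {P : V → Prop} (root : P r)
    (step : ∀ v, v ≠ r → P (par v) → P v) (v : V) : P v := by
  induction hn : X v using Nat.strong_induction_on generalizing v with
  | _ n ih =>
    by_cases hv : v = r
    · rwa [hv]
    · exact step v hv (ih _ (hn ▸ h.par_lt v hv) _ rfl)

theorem Layout.isTree [Fintype V] (h : Layout G r X par σ Y) : (parentGraph r par).IsTree := by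
  classical
  rw [SimpleGraph.isTree_iff_connected_and_card]
  constructor
  · have hr : ∀ v, (parentGraph r par).Reachable r v :=
      h.induction (SimpleGraph.Reachable.refl r)
        fun v hv ih => ih.trans (h.parentGraph_adj hv).reachable
    exact (SimpleGraph.connected_iff _).2 ⟨fun u v => (hr u).symm.trans (hr v), ⟨r⟩⟩
  · have hedge : (parentGraph r par).edgeSet = (fun v => s(par v, v)) '' {v | v ≠ r} := by
      ext e
      induction e with
      | _ u v =>
        simp only [SimpleGraph.mem_edgeSet, Set.mem_image, Set.mem_ofPred_eq]
        constructor
        · intro huv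
          rcases ((SimpleGraph.fromRel_adj _ _ _).1 huv).2 with ⟨hv, rfl⟩ | ⟨hv, rfl⟩
          · exact ⟨v, hv, rfl⟩
          · exact ⟨u, hv, Sym2.eq_swap⟩
        · rintro ⟨z, hz, hzuv⟩
          rw [← SimpleGraph.mem_edgeSet, ← hzuv, SimpleGraph.mem_edgeSet]
          exact h.parentGraph_adj hz
    have hinj : Set.InjOn (fun v => s(par v, v)) {v | v ≠ r} := by
      intro u hu v hv huv
      rcases Sym2.eq_iff.1 huv with huv | huv
      · exact huv.2
      · have h1 := h.par_lt u hu
        have h2 := h.par_lt v hv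
        rw [huv.1] at h1
        rw [← huv.2] at h2
        exact absurd h1 h2.not_gt
    rw [hedge, Nat.card_image_of_injOn hinj]
    have : ({v | v ≠ r} : Set V) = {r}ᶜ := by ext; simp
    rw [this, Nat.card_coe_set_eq, Nat.card_eq_fintype_card, ← Nat.card_eq_fintype_card,
      ← Set.ncard_singleton r, add_comm]
    exact Set.ncard_add_ncard_compl _

/-- A step of a walk in the graph `T` that is increasing in direction `d`. -/
def AscStep (T : SimpleGraph V) (f : V → ℝ × ℝ) (d : ℝ × ℝ) (x y : V) : Prop :=
  T.Adj x y ∧ 0 < dot (f y - f x) d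

theorem exists_monotone_path {T : SimpleGraph V} {f : V → ℝ × ℝ} {d : ℝ × ℝ} (hd : d ≠ 0)
    {a b : V} (h : Relation.ReflTransGen (AscStep T f d) a b) :
    ∃ w : T.Walk a b, w.IsPath ∧ MonotoneWalk f w := by
  suffices hw : ∃ w : T.Walk a b, w.support.IsChain fun x y => 0 < dot (f y - f x) d by
    obtain ⟨w, hw⟩ := hw
    refine ⟨w, ?_, d, hd, hw⟩
    rw [SimpleGraph.Walk.isPath_def]
    have hdot : ∀ x y, 0 < dot (f y - f x) d ↔ dot (f x) d < dot (f y) d := by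
      intro x y
      rw [← sub_pos (b := dot (f x) d)]
      simp only [dot, Prod.fst_sub, Prod.snd_sub]
      ring_nf
    simp only [hdot] at hw
    have : IsTrans V fun x y => dot (f x) d < dot (f y) d := ⟨fun _ _ _ h1 h2 => h1.trans h2⟩
    exact hw.pairwise.imp fun h e => by rw [e] at h; exact lt_irrefl _ h
  induction h using Relation.ReflTransGen.head_induction_on with
  | refl => exact ⟨.nil, by simp⟩
  | head hxy _ ih =>
    obtain ⟨w, hw⟩ := ih
    refine ⟨.cons hxy.1 w, ?_⟩
    cases w with
    | nil => simpa using hxy.2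
    | cons _ _ => simpa using ⟨hxy.2, by simpa using hw⟩

variable {κ : V → List ℕ}

theorem Layout.exists_of_prefix (h : Layout G r X par σ Y) (hκr : κ r = [])
    (hκ : ∀ v, v ≠ r → ∃ j, κ v = κ (par v) ++ [j]) (v : V) :
    ∀ p, p <+: κ v → ∃ u, κ u = p := by
  induction v using h.induction with
  | root => exact fun p hp => ⟨r, by rw [hκr] at hp ⊢; exact (List.prefix_nil.1 hp).symm⟩
  | step v hv ih =>
    obtain ⟨j, hj⟩ := hκ v hv
    intro p hp
    rw [hj, List.prefix_concat_iff] at hp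
    rcases hp with rfl | hp
    · exact ⟨v, hj⟩
    · exact ih p hp

theorem Layout.reflTransGen (h : Layout G r X par σ Y) (hκr : κ r = [])
    (hκ : ∀ v, v ≠ r → ∃ j, κ v = κ (par v) ++ [j]) (hκi : Function.Injective κ) {m a : V}
    (hma : κ m <+: κ a) {Q : V → V → Prop}
    (hQ : ∀ z, z ≠ r → κ z <+: κ a → ¬ κ z <+: κ m → Q (par z) z) :
    Relation.ReflTransGen Q m a := by
  induction a using h.induction with
  | root =>
    rw [hκr, List.prefix_nil, ← hκr] at hma
    rw [hκi hma]
  | step v hv ih =>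
    obtain ⟨j, hj⟩ := hκ v hv
    by_cases hvm : κ v <+: κ m
    · rw [hκi (hma.eq_of_length_le hvm.length_le)]
    · have hmp : κ m <+: κ (par v) := by
        rw [hj, List.prefix_concat_iff] at hma
        refine hma.resolve_left fun e => hvm ?_
        rw [e, ← hj]
      have hpv : κ (par v) <+: κ v := hj ▸ List.prefix_append _ _
      exact (ih hmp fun z hzr hz => hQ z hzr (hz.trans hpv)).tail (hQ v hv List.prefix_rfl hvm)

theorem Layout.exists_ascending [Fintype V] (h : Layout G r X par σ Y) (hκr : κ r = [])
    (hκ : ∀ v, v ≠ r → ∃ j, κ v = κ (par v) ++ [j]) (hκi : Function.Injective κ)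
    (hσκ : ∀ u v, σ u < σ v ↔ κ u < κ v) {a b : V} (hab : a ≠ b) :
    ∃ d : ℝ × ℝ, d ≠ 0 ∧ Relation.ReflTransGen
      (AscStep (parentGraph r par) (fun v => ((X v : ℝ), Y v)) d) a b := by
  classical
  wlog hlt : κ a < κ b generalizing a b
  · obtain ⟨d, hd, hba⟩ := this hab.symm
      (lt_of_le_of_ne (not_lt.1 hlt) (hκi.ne hab.symm))
    refine ⟨-d, neg_ne_zero.2 hd, Relation.ReflTransGen.mono (fun x y hxy => ⟨hxy.1.symm, ?_⟩) _ _
      (Relation.reflTransGen_swap.2 hba)⟩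
    have := hxy.2
    simp only [dot, Prod.fst_sub, Prod.snd_sub, Prod.fst_neg, Prod.snd_neg] at this ⊢
    linarith
  obtain ⟨m, hm, hmax⟩ := Finset.exists_max_image
    (Finset.univ.filter fun m => κ m <+: κ a ∧ κ m <+: κ b) (fun m => (κ m).length)
    ⟨r, by simp [hκr]⟩
  simp only [Finset.mem_filter, Finset.mem_univ, true_and] at hm hmax
  have hA : ∀ z, κ z <+: κ a → ¬ κ z <+: κ m → ¬ κ z <+: κ b := fun z hz hzm hzb =>
    hzm (List.prefix_of_prefix_length_le hz hm.1 (hmax z ⟨hz, hzb⟩))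
  have hB : ∀ z, κ z <+: κ b → ¬ κ z <+: κ m → ¬ κ z <+: κ a := fun z hz hzm hza =>
    hzm (List.prefix_of_prefix_length_le hza hm.1 (hmax z ⟨hza, hz⟩))
  obtain ⟨D, hD1, hD2⟩ := Order.exists_between_finsets
    ((Finset.univ.filter fun z => κ z <+: κ a ∧ ¬ κ z <+: κ m).image σ)
    ((Finset.univ.filter fun z => κ z <+: κ b ∧ ¬ κ z <+: κ m).image σ) (by
      simp only [Finset.mem_image, Finset.mem_filter, Finset.mem_univ, true_and]
      rintro _ ⟨z, ⟨hza, hzm⟩, rfl⟩ _ ⟨z', ⟨hzb, hzm'⟩, rfl⟩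
      rw [hσκ]
      have h1 := hA z hza hzm
      have h2 := hB z' hzb hzm'
      obtain ⟨x, hx⟩ := hza
      obtain ⟨y, hy⟩ := id hzb
      have h3 : κ z < κ b := (lt_iff_append_lt x h1).2 (hx ▸ hlt)
      have h4 : ¬ κ z' <+: κ z := fun h4 => h2 (h4.trans ⟨x, hx⟩)
      have h5 := lt_iff_append_lt y h4
      rw [hy] at h5
      refine lt_of_le_of_ne (not_lt.1 fun h6 => h3.not_gt (h5.1 h6)) fun h6 => h1 ?_
      rwa [h6])
  simp only [Finset.mem_image, Finset.mem_filter, Finset.mem_univ, true_and, forall_exists_index,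
    and_imp] at hD1 hD2
  have hslope : ∀ z, z ≠ r → dot (((X z : ℝ), Y z) - ((X (par z) : ℝ), Y (par z))) (-D, 1) =
      (X z - X (par z)) * (σ z - D) := by
    intro z hz
    simp only [dot, Prod.fst_sub, Prod.snd_sub, h.height z hz]
    ring
  have hpos : ∀ z, z ≠ r → 0 < (X z : ℝ) - X (par z) := fun z hz =>
    sub_pos.2 (by exact_mod_cast h.par_lt z hz)
  refine ⟨(-D, 1), fun e => one_ne_zero (congrArg Prod.snd e), Relation.ReflTransGen.trans (b := m)
    (Relation.reflTransGen_swap.1 ?_) ?_⟩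
  · refine h.reflTransGen hκr hκ hκi hm.1 fun z hzr hz hzm => ⟨(h.parentGraph_adj hzr).symm, ?_⟩
    have h1 := hslope z hzr
    have h2 := mul_neg_of_pos_of_neg (hpos z hzr) (sub_neg.2 (hD1 _ z hz hzm rfl))
    rw [← h1] at h2
    simp only [dot, Prod.fst_sub, Prod.snd_sub] at h2 ⊢
    linarith
  · refine h.reflTransGen hκr hκ hκi hm.2 fun z hzr hz hzm => ⟨h.parentGraph_adj hzr, ?_⟩
    rw [hslope z hzr]
    exact mul_pos (hpos z hzr) (sub_pos.2 (hD2 _ z hz hzm rfl))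

theorem exists_heights (r : V) (X : V → ℕ) (par : V → V) (s : V → ℕ)
    (hlt : ∀ v, v ≠ r → X (par v) < X v) (n : ℕ) (hs : ∀ v, s v ≤ n) :
    ∃ Y : V → ℕ, (∀ v, Y v ≤ n * X v) ∧
      ∀ v, v ≠ r → Y v = Y (par v) + s v * (X v - X (par v)) := by
  classical
  let Y : V → ℕ := (measure X).wf.fix fun v rec =>
    if hv : v = r then 0 else rec (par v) (hlt v hv) + s v * (X v - X (par v))
  have hY : ∀ v, Y v = if v = r then 0 else Y (par v) + s v * (X v - X (par v)) := by
    intro v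
    rw [show Y v = _ from WellFounded.fix_eq _ _ _]
    rfl
  refine ⟨Y, fun v => ?_, fun v hv => by rw [hY v, if_neg hv]⟩
  induction hn : X v using Nat.strong_induction_on generalizing v with
  | _ k ih =>
    subst hn
    rw [hY v]
    split_ifs with hv
    · exact Nat.zero_le _
    · have := hlt v hv
      calc Y (par v) + s v * (X v - X (par v))
          ≤ n * X (par v) + n * (X v - X (par v)) :=
            Nat.add_le_add (ih _ this _ rfl) (Nat.mul_le_mul_right _ (hs v))
        _ = n * X v := by rw [← Nat.mul_add, Nat.add_sub_cancel' this.le]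

end Tree

theorem exists_drawing_of_bounds {V : Type} [Fintype V] {G : SimpleGraph V} {rot : V → List V}
    {r : V} (hG : G.Connected) (hrot : IsRotation G rot)
    (hr : Bounds rot {v | v ≠ r} ((rot r).map fun u => (r, u))) :
    ∃ (T : SimpleGraph V) (g : V → ℤ × ℤ), T ≤ G ∧ T.IsTree ∧ IsMonotoneDrawing G (gridMap g) ∧
      (∀ v : V, 0 ≤ (g v).1 ∧ ((g v).1 : ℝ) ≤ 1 * (Fintype.card V : ℝ) ∧
        0 ≤ (g v).2 ∧ ((g v).2 : ℝ) ≤ 1 * (Fintype.card V : ℝ) ^ 2) ∧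
      ∀ a b : V, a ≠ b → ∃ w : T.Walk a b, w.IsPath ∧ MonotoneWalk (gridMap g) w := by
  classical
  obtain ⟨X, par, κ, ℓ, w, h⟩ := exists_complete_peelState hrot hG hr
  have hXlt : ∀ v, X v < Fintype.card V := by
    have := (Finset.card_eq_iff_eq_univ _).1 h.card_placed
    intro v
    have hv := Finset.mem_univ v
    rw [← this] at hv
    exact (Finset.mem_filter.1 hv).2
  have hnbr : ∀ v, v ≠ r → ∃ u, G.Adj u v ∧ X u < Fintype.card V := fun v hv =>
    h.placed_nbr v hv (hXlt v)
  have hκi : Function.Injective κ := by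
    intro u v huv
    refine h.key_inj u v ?_ ?_ huv
    · exact (em _).imp_right (hnbr u)
    · exact (em _).imp_right (hnbr v)
  have hκ : ∀ v, v ≠ r → ∃ j, κ v = κ (par v) ++ [j] := fun v hv =>
    (h.par_spec v hv (hnbr v hv)).2.2.2
  have hlt : ∀ v, v ≠ r → X (par v) < X v := fun v hv => (h.par_spec v hv (hnbr v hv)).2.1
  obtain ⟨s, hs⟩ : ∃ s : V → ℕ, s = fun v => (Finset.univ.filter fun u => κ u < κ v).card :=
    ⟨_, rfl⟩
  have hsmono : ∀ u v, κ u < κ v → s u < s v := by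
    intro u v huv
    simp only [hs]
    refine Finset.card_lt_card ⟨fun z hz => ?_, fun hsub => ?_⟩
    · simp only [Finset.mem_filter, Finset.mem_univ, true_and] at hz ⊢
      exact hz.trans huv
    · have := hsub (Finset.mem_filter.2 ⟨Finset.mem_univ u, huv⟩)
      simp at this
  have hsκ : ∀ u v, s u < s v ↔ κ u < κ v := by
    intro u v
    refine ⟨fun huv => ?_, hsmono u v⟩
    rcases lt_trichotomy (κ u) (κ v) with h1 | h1 | h1
    · exact h1
    · rw [hκi h1] at huv
      exact absurd huv (lt_irrefl _)
    · exact absurd huv (hsmono v u h1).not_gt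
  have hsi : Function.Injective s := by
    intro u v huv
    by_contra hne
    rcases lt_or_gt_of_ne (hκi.ne hne) with h1 | h1
    · exact (hsmono _ _ h1).ne huv
    · exact (hsmono _ _ h1).ne' huv
  obtain ⟨Y, hYle, hY⟩ := exists_heights r X par s hlt (Fintype.card V)
    fun v => by rw [hs]; exact Finset.card_le_univ _
  have hL : Layout G r X par (fun v => (s v : ℝ)) (fun v => (Y v : ℝ)) :=
    { time_inj := fun u v huv => h.inj_placed u v (hXlt u) huv
      root_time := h.root_time
      slope_inj := fun u v huv => hsi (Nat.cast_injective huv)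
      par_adj := fun v hv => (h.par_spec v hv (hnbr v hv)).1
      par_lt := hlt
      par_le := fun v hv => (h.par_spec v hv (hnbr v hv)).2.2.1
      consistent := by
        intro u v z q huv hXuv hXuz hzv hqz hqu
        simp only [Nat.cast_lt, hsκ]
        exact h.consistent u v z (hXlt u) huv hXuv hXuz hzv ⟨q, hqz, hqu⟩
      height := by
        intro v hv
        rw [hY v hv]
        push_cast [Nat.cast_sub (hlt v hv).le]
        ring }
  have hasc : ∀ a b, a ≠ b → _ := fun a b hab => hL.exists_ascending h.root_key hκ hκi
    (by simpa using hsκ) hab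
  refine ⟨parentGraph r par, fun v => ((X v : ℤ), (Y v : ℤ)), hL.parentGraph_le, hL.isTree, ?_⟩
  have hg : (gridMap fun v => ((X v : ℤ), (Y v : ℤ))) = fun v => ((X v : ℝ), (Y v : ℝ)) := by
    funext v
    simp [gridMap]
  rw [hg]
  refine ⟨⟨hL.isPlanarDrawing hG, fun a b hab => ?_⟩, fun v => ?_, fun a b hab => ?_⟩
  · obtain ⟨d, hd, hab⟩ := hasc a b hab
    exact exists_monotone_path hd (Relation.ReflTransGen.mono
      (fun x y hxy => ⟨hL.parentGraph_le hxy.1, hxy.2⟩) _ _ hab)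
  · have h1 := (hXlt v).le
    have h2 : Y v ≤ Fintype.card V ^ 2 :=
      (hYle v).trans (by rw [sq]; exact Nat.mul_le_mul_left _ h1)
    refine ⟨Int.natCast_nonneg _, ?_, Int.natCast_nonneg _, ?_⟩
    · rw [one_mul]
      exact Int.cast_natCast (R := ℝ) (X v) ▸ Nat.cast_le.2 h1
    · rw [one_mul, ← Nat.cast_pow]
      exact Int.cast_natCast (R := ℝ) (Y v) ▸ Nat.cast_le.2 h2
  · obtain ⟨d, hd, hab⟩ := hasc a b hab
    exact exists_monotone_path hd hab

section Sweep

/-- The slope of the segment that joins the points with indices `a` and `b`. -/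
noncomputable def slopeAt {V : Type} (x y : V → ℝ) (a b : V) : ℝ := (y b - y a) / (x b - x a)

/-- The height at abscissa `t` of the line through the points with indices `a` and `b`. -/
noncomputable def heightAt {V : Type} (x y : V → ℝ) (a b : V) (t : ℝ) : ℝ :=
  y a + slopeAt x y a b * (t - x a)

/-- Planarity of the drawing with coordinates `x` and `y`, in which no edge is vertical,
in terms of the heights of the edges. -/
structure IsGenericDrawing {V : Type} (G : SimpleGraph V) (x y : V → ℝ) : Prop where
  inj : Function.Injective x
  cross : ∀ a b c d, G.Adj a b → G.Adj c d → x a < x b → x c < x d → (a, b) ≠ (c, d) →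
    ∀ t, x a ≤ t → t ≤ x b → x c ≤ t → t ≤ x d → heightAt x y a b t = heightAt x y c d t →
      ∃ z, (z = a ∨ z = b) ∧ (z = c ∨ z = d) ∧ x z = t
  avoid : ∀ a b c, G.Adj a b → x a < x c → x c < x b → heightAt x y a b (x c) ≠ y c

theorem exists_shear {V : Type} [Fintype V] {f : V → ℝ × ℝ} (hf : Function.Injective f) :
    ∃ c : ℝ, Function.Injective fun v => (f v).1 + c * (f v).2 := by
  classical
  obtain ⟨c, hc⟩ := Infinite.exists_notMem_finset (Finset.univ.image fun e : V × V =>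
    -((f e.1).1 - (f e.2).1) / ((f e.1).2 - (f e.2).2))
  refine ⟨c, fun u v huv => ?_⟩
  by_contra hne
  simp only at huv
  by_cases h2 : (f u).2 = (f v).2
  · refine hne (hf (Prod.ext ?_ h2))
    rw [h2] at huv
    linarith
  · refine hc (Finset.mem_image.2 ⟨(u, v), Finset.mem_univ _, ?_⟩)
    rw [div_eq_iff (sub_ne_zero.2 h2)]
    linarith

theorem exists_isGenericDrawing {V : Type} [Fintype V] {G : SimpleGraph V}
    {f : V → ℝ × ℝ} (hf : IsPlanarDrawing G f) : ∃ x y, IsGenericDrawing G x y := by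
  obtain ⟨c, hc⟩ := exists_shear hf.1
  obtain ⟨x, hx⟩ : ∃ x : V → ℝ, x = fun v => (f v).1 + c * (f v).2 := ⟨_, rfl⟩
  obtain ⟨y, hy⟩ : ∃ y : V → ℝ, y = fun v => (f v).2 := ⟨_, rfl⟩
  rw [← hx] at hc
  have hfv : ∀ v, f v = (x v - c * y v, y v) := fun v => by
    rw [hx, hy]
    ext <;> simp
  have hcomb : ∀ a b t, x a < x b →
      (1 - (t - x a) / (x b - x a)) • f a + ((t - x a) / (x b - x a)) • f b =
        (t - c * heightAt x y a b t, heightAt x y a b t) := by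
    intro a b t hab
    have hne : x b - x a ≠ 0 := (sub_pos.2 hab).ne'
    rw [hfv a, hfv b]
    ext
    · simp only [heightAt, slopeAt, Prod.fst_add, Prod.smul_fst, smul_eq_mul]
      field_simp
      ring
    · simp only [heightAt, slopeAt, Prod.snd_add, Prod.smul_snd, smul_eq_mul]
      field_simp
      ring
  have hseg : ∀ a b t, x a < x b → x a ≤ t → t ≤ x b →
      (t - c * heightAt x y a b t, heightAt x y a b t) ∈ segment ℝ (f a) (f b) := by
    intro a b t hab hat htb
    have hpos := sub_pos.2 hab
    exact ⟨_, _, sub_nonneg.2 ((div_le_one hpos).2 (by linarith)),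
      div_nonneg (by linarith) hpos.le, by ring, hcomb a b t hab⟩
  refine ⟨x, y, hc, ?_, ?_⟩
  · intro a b c' d hab hcd hxab hxcd hne t h1 h2 h3 h4 heq
    have hs : s(a, b) ≠ s(c', d) := by
      intro hs
      rcases Sym2.eq_iff.1 hs with ⟨rfl, rfl⟩ | ⟨rfl, rfl⟩
      · exact hne rfl
      · exact hxab.not_gt hxcd
    obtain ⟨z, hz, hz', hzp⟩ := hf.2.1 a b c' d hab hcd hs _ (hseg a b t hxab h1 h2)
      (heq ▸ hseg c' d t hxcd h3 h4)
    refine ⟨z, hz, hz', ?_⟩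
    rw [hfv z, Prod.mk.injEq] at hzp
    rw [hzp.2] at hzp
    linarith [hzp.1]
  · intro a b z hab haz hzb heq
    refine hf.2.2 a b z hab ?_ ?_ ?_
    · rintro rfl
      exact lt_irrefl _ haz
    · rintro rfl
      exact lt_irrefl _ hzb
    · have hlt := haz.trans hzb
      have hpos := sub_pos.2 hlt
      refine ⟨_, _, sub_pos.2 ((div_lt_one hpos).2 (by linarith)),
        div_pos (by linarith) hpos, by ring, (hcomb a b (x z) hlt).trans ?_⟩
      rw [heq, hfv z]

theorem exists_sorted_list {V : Type} (S : Finset V) (k : V → ℝ) (hk : Set.InjOn k S) :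
    ∃ l : List V, (∀ u, u ∈ l ↔ u ∈ S) ∧ l.Pairwise (k · < k ·) := by
  classical
  induction S using Finset.induction_on_max_value k with
  | empty => exact ⟨[], by simp⟩
  | insert a s ha hmax ih =>
    obtain ⟨l, hl, hl'⟩ := ih (hk.mono (by simp))
    refine ⟨l ++ [a], fun u => by simp [hl, or_comm], ?_⟩
    rw [List.pairwise_append]
    refine ⟨hl', List.pairwise_singleton _ _, fun u hu b hb => ?_⟩
    rw [List.mem_singleton.1 hb]
    refine lt_of_le_of_ne (hmax u ((hl u).1 hu)) fun e => ha ?_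
    rw [← hk (by simp [(hl u).1 hu]) (by simp) e]
    exact (hl u).1 hu

theorem eq_filter_append {α : Type*} (l : List α) (k : α → ℝ) (c : ℝ)
    (hl : l.Pairwise (k · ≤ k ·)) :
    l = l.filter (k · < c) ++ l.filter (k · = c) ++ l.filter (c < k ·) := by
  induction l with
  | nil => simp
  | cons a l ih =>
    obtain ⟨ha, hl⟩ := List.pairwise_cons.1 hl
    have ih := ih hl
    rcases lt_trichotomy (k a) c with h | h | h
    · rw [List.filter_cons_of_pos (by simpa using h), List.filter_cons_of_neg (by simpa using h.ne),
        List.filter_cons_of_neg (by simpa using h.le), List.cons_append, List.cons_append, ← ih]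
    · have h1 : l.filter (k · < c) = [] := by
        rw [List.filter_eq_nil_iff]
        intro b hb
        simpa [← h] using ha b hb
      rw [h1] at ih
      rw [List.filter_cons_of_neg (by simpa using h.ge), List.filter_cons_of_pos (by simpa using h),
        List.filter_cons_of_neg (by simpa using h.le), h1, List.nil_append, List.cons_append]
      exact congrArg _ ih
    · have h1 : l.filter (k · < c) = [] := by
        rw [List.filter_eq_nil_iff]
        intro b hb
        simpa using h.le.trans (ha b hb)
      have h2 : l.filter (k · = c) = [] := by
        rw [List.filter_eq_nil_iff]
        intro b hb
        simpa using (h.trans_le (ha b hb)).ne'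
      rw [h1, h2] at ih
      rw [List.filter_cons_of_neg (by simpa using h.le),
        List.filter_cons_of_neg (by simpa using h.ne'), List.filter_cons_of_pos (by simpa using h),
        h1, h2]
      exact congrArg _ ih

variable {V : Type} {G : SimpleGraph V} {x y : V → ℝ}

theorem slopeAt_comm (a b : V) : slopeAt x y a b = slopeAt x y b a := by
  rw [slopeAt, slopeAt, ← neg_sub (y a), ← neg_sub (x a), neg_div_neg_eq]

theorem heightAt_comm {a b : V} (hab : x a ≠ x b) (t : ℝ) :
    heightAt x y a b t = heightAt x y b a t := by
  have h1 : x b - x a ≠ 0 := sub_ne_zero.2 hab.symm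
  have h2 : slopeAt x y a b * (x b - x a) = y b - y a := div_mul_cancel₀ _ h1
  rw [heightAt, heightAt, slopeAt_comm b a]
  linarith

theorem heightAt_left (a b : V) : heightAt x y a b (x a) = y a := by simp [heightAt]

theorem heightAt_right {a b : V} (hab : x a ≠ x b) : heightAt x y a b (x b) = y b := by
  rw [heightAt_comm hab, heightAt_left]

theorem heightAt_lt_heightAt_iff {a b c : V} {t : ℝ} (ht : x a < t) :
    heightAt x y a b t < heightAt x y a c t ↔ slopeAt x y a b < slopeAt x y a c := by
  rw [heightAt, heightAt, add_lt_add_iff_left, mul_lt_mul_iff_left₀ (sub_pos.2 ht)]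

theorem heightAt_lt_heightAt_iff_of_gt {a b c : V} {t : ℝ} (ht : t < x a) :
    heightAt x y a b t < heightAt x y a c t ↔ slopeAt x y a c < slopeAt x y a b := by
  rw [heightAt, heightAt, add_lt_add_iff_left, mul_lt_mul_right_of_neg (sub_neg.2 ht)]

theorem IsGenericDrawing.heightAt_le (h : IsGenericDrawing G x y) {a b c d : V} (hab : G.Adj a b)
    (hcd : G.Adj c d) {p q : ℝ} (hpq : p < q) (hap : x a ≤ p) (hqb : q ≤ x b) (hcp : x c ≤ p)
    (hqd : q ≤ x d) (hno : ∀ v, p < x v → ¬ x v < q)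
    (hlt : heightAt x y a b p < heightAt x y c d p) :
    heightAt x y a b q ≤ heightAt x y c d q := by
  by_contra! hcon
  have hne : (a, b) ≠ (c, d) := by
    rintro ⟨⟩
    exact lt_irrefl _ hlt
  obtain ⟨t, ⟨hpt, htq⟩, ht⟩ : ∃ t ∈ Set.Ioo p q, heightAt x y a b t - heightAt x y c d t = 0 := by
    refine intermediate_value_Ioo hpq.le ?_ ⟨by linarith, by linarith⟩
    unfold heightAt
    fun_prop
  obtain ⟨z, -, -, hz⟩ := h.cross a b c d hab hcd (by linarith) (by linarith) hne t (by linarith)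
    (by linarith) (by linarith) (by linarith) (sub_eq_zero.1 ht)
  exact hno z (by linarith) (by linarith)

theorem IsGenericDrawing.heightAt_lt (h : IsGenericDrawing G x y) {a b c d : V} (hab : G.Adj a b)
    (hcd : G.Adj c d) {p q : ℝ} (hpq : p < q) (hap : x a ≤ p) (hqb : q < x b) (hcp : x c ≤ p)
    (hqd : q < x d) (hno : ∀ v, p < x v → ¬ x v < q)
    (hlt : heightAt x y a b p < heightAt x y c d p) :
    heightAt x y a b q < heightAt x y c d q := by
  refine lt_of_le_of_ne (h.heightAt_le hab hcd hpq hap hqb.le hcp hqd.le hno hlt) fun heq => ?_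
  have hne : (a, b) ≠ (c, d) := by
    rintro ⟨⟩
    exact lt_irrefl _ hlt
  obtain ⟨z, hz, -, hzq⟩ := h.cross a b c d hab hcd (by linarith) (by linarith) hne q
    (by linarith) (by linarith) (by linarith) (by linarith) heq
  rcases hz with rfl | rfl <;> linarith

theorem IsGenericDrawing.slopeAt_injOn_right (h : IsGenericDrawing G x y) (v : V) :
    Set.InjOn (slopeAt x y v) {u | G.Adj v u ∧ x v < x u} := by
  rintro a ⟨ha, hva⟩ b ⟨hb, hvb⟩ hab
  by_contra hne
  obtain ⟨z, hz, hz', hzt⟩ := h.cross v a v b ha hb hva hvb (fun e => hne (Prod.mk.inj e).2)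
    (min (x a) (x b)) (le_min hva.le hvb.le) (min_le_left _ _) (le_min hva.le hvb.le)
    (min_le_right _ _) (by rw [heightAt, heightAt, hab])
  have := lt_min hva hvb
  grind

theorem IsGenericDrawing.slopeAt_injOn_left (h : IsGenericDrawing G x y) (v : V) :
    Set.InjOn (slopeAt x y v) {u | G.Adj v u ∧ x u < x v} := by
  rintro a ⟨ha, hva⟩ b ⟨hb, hvb⟩ hab
  by_contra hne
  obtain ⟨z, hz, hz', hzt⟩ := h.cross a v b v ha.symm hb.symm hva hvb
    (fun e => hne (Prod.mk.inj e).1) (max (x a) (x b)) (le_max_left _ _) (max_le hva.le hvb.le)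
    (le_max_right _ _) (max_le hva.le hvb.le)
    (by rw [heightAt_comm hva.ne, heightAt_comm hvb.ne, heightAt, heightAt, hab])
  have := max_lt hva hvb
  grind

theorem exists_between_next [Fintype V] (x : V → ℝ) (s : ℝ) :
    ∃ t, s < t ∧ ∀ v, s < x v → t < x v := by
  classical
  obtain ⟨t, h1, h2⟩ := Order.exists_between_finsets {s}
    ((Finset.univ.filter fun v => s < x v).image x) (by simp)
  exact ⟨t, by simpa using h1, fun v hv => h2 _ (Finset.mem_image_of_mem _ (by simpa using hv))⟩

/-- Sweeping a vertical line to the right: the holonomy along it stays trivial. -/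
theorem IsGenericDrawing.sweep [Fintype V] (h : IsGenericDrawing G x y) {Rt Lf : V → List V}
    (hRt : ∀ v u, u ∈ Rt v ↔ G.Adj v u ∧ x v < x u)
    (hRs : ∀ v, (Rt v).Pairwise (slopeAt x y v · < slopeAt x y v ·))
    (hLf : ∀ v u, u ∈ Lf v ↔ G.Adj v u ∧ x u < x v)
    (hLs : ∀ v, (Lf v).Pairwise (slopeAt x y v · < slopeAt x y v ·))
    {μ : V → V → Equiv.Perm (Fin 3)} (hμ : IsGauge μ) (t : ℝ) (ht : ∀ v, x v ≠ t)
    (htriv : ∀ v, t < x v → ((Rt v ++ Lf v).map (μ v)).prod = 1) (w : List (V × V))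
    (hw : ∀ e, e ∈ w ↔ G.Adj e.1 e.2 ∧ x e.1 < t ∧ t < x e.2)
    (hws : w.Pairwise fun e e' => heightAt x y e.1 e.2 t < heightAt x y e'.1 e'.2 t) :
    (w.map fun e => μ e.1 e.2).prod = 1 := by
  classical
  induction hn : (Finset.univ.filter fun v => t < x v).card using Nat.strong_induction_on
    generalizing t w with
  | _ n ih =>
    rcases (Finset.univ.filter fun v => t < x v).eq_empty_or_nonempty with hemp | hne
    · have : w = [] := List.eq_nil_iff_forall_not_mem.2 fun e he => by
        have : e.2 ∈ Finset.univ.filter fun v => t < x v := by simp [((hw e).1 he).2.2]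
        rw [hemp] at this
        simp at this
      simp [this]
    obtain ⟨v, hv, hmin⟩ := Finset.exists_min_image _ x hne
    simp only [Finset.mem_filter, Finset.mem_univ, true_and] at hv hmin
    obtain ⟨t', hvt', ht'⟩ := exists_between_next x (x v)
    have hbefore : ∀ u, x u < x v → x u < t := fun u hu =>
      lt_of_le_of_ne (not_lt.1 fun h' => (hmin u h').not_gt hu) (ht u)
    have hafter : ∀ u, x u < t' → x u ≤ x v := fun u hu => not_lt.1 fun h' => (ht' u h').not_gt hu
    have hend : ∀ e ∈ w, e.2 ≠ v → t' < x e.2 := fun e he hev => ht' _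
      (lt_of_le_of_ne (hmin _ ((hw e).1 he).2.2) (h.inj.ne hev.symm))
    have hendv : ∀ e ∈ w, heightAt x y e.1 e.2 (x v) = y v ↔ e.2 = v := by
      intro e he
      obtain ⟨he1, he2, he3⟩ := (hw e).1 he
      constructor
      · intro heq
        by_contra hev
        exact h.avoid _ _ _ he1 (he2.trans hv) (hvt'.trans (hend e he hev)) heq
      · rintro rfl
        exact heightAt_right (he2.trans he3).ne
    have hweak : w.Pairwise fun e e' =>
        heightAt x y e.1 e.2 (x v) ≤ heightAt x y e'.1 e'.2 (x v) := by
      refine hws.imp_of_mem fun {e e'} he he' hlt => ?_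
      obtain ⟨he1, he2, he3⟩ := (hw e).1 he
      obtain ⟨he1', he2', he3'⟩ := (hw e').1 he'
      exact h.heightAt_le he1 he1' hv he2.le (hmin _ he3) he2'.le (hmin _ he3')
        (fun u hu => (hmin u hu).not_gt) hlt
    have hsplit := eq_filter_append w (fun e => heightAt x y e.1 e.2 (x v)) (y v) hweak
    obtain ⟨A, hA⟩ : ∃ A, A = w.filter fun e => heightAt x y e.1 e.2 (x v) < y v := ⟨_, rfl⟩
    obtain ⟨I, hI⟩ : ∃ I, I = w.filter fun e => heightAt x y e.1 e.2 (x v) = y v := ⟨_, rfl⟩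
    obtain ⟨B, hB⟩ : ∃ B, B = w.filter fun e => y v < heightAt x y e.1 e.2 (x v) := ⟨_, rfl⟩
    rw [← hA, ← hI, ← hB] at hsplit
    have hAmem : ∀ e, e ∈ A ↔ e ∈ w ∧ heightAt x y e.1 e.2 (x v) < y v := by simp [hA]
    have hBmem : ∀ e, e ∈ B ↔ e ∈ w ∧ y v < heightAt x y e.1 e.2 (x v) := by simp [hB]
    have hImem : ∀ e, e ∈ I ↔ e ∈ w ∧ e.2 = v := by
      intro e
      rw [hI, List.mem_filter, decide_eq_true_eq]
      exact and_congr_right (hendv e)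
    have hAv : ∀ e ∈ A, e ∈ w ∧ e.2 ≠ v := fun e he =>
      ⟨((hAmem e).1 he).1, fun hev => ((hAmem e).1 he).2.ne ((hendv e ((hAmem e).1 he).1).2 hev)⟩
    have hBv : ∀ e ∈ B, e ∈ w ∧ e.2 ≠ v := fun e he =>
      ⟨((hBmem e).1 he).1, fun hev => ((hBmem e).1 he).2.ne' ((hendv e ((hBmem e).1 he).1).2 hev)⟩
    have hIrev : (I.map Prod.fst).reverse = Lf v := by
      have : Std.Irrefl fun a b => slopeAt x y v a < slopeAt x y v b := ⟨fun _ => lt_irrefl _⟩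
      have : Std.Antisymm fun a b => slopeAt x y v a < slopeAt x y v b :=
        ⟨fun _ _ h1 h2 => absurd h1 h2.not_gt⟩
      refine List.Subset.antisymm_of_pairwise (r := fun a b => slopeAt x y v a < slopeAt x y v b)
        ?_ (hLs v) ?_ ?_
      · rw [List.pairwise_reverse, List.pairwise_map]
        refine (hws.sublist (hI ▸ List.filter_sublist)).imp_of_mem fun {e e'} he he' hlt => ?_
        obtain ⟨he, hev⟩ := (hImem e).1 he
        obtain ⟨he', hev'⟩ := (hImem e').1 he'
        obtain ⟨-, he2, he3⟩ := (hw e).1 he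
        obtain ⟨-, he2', he3'⟩ := (hw e').1 he'
        rw [heightAt_comm (he2.trans he3).ne, heightAt_comm (he2'.trans he3').ne, hev, hev'] at hlt
        exact (heightAt_lt_heightAt_iff_of_gt hv).1 hlt
      · intro u hu
        obtain ⟨e, he, rfl⟩ := List.mem_map.1 (List.mem_reverse.1 hu)
        obtain ⟨he, rfl⟩ := (hImem e).1 he
        obtain ⟨he1, he2, he3⟩ := (hw e).1 he
        exact (hLf _ _).2 ⟨he1.symm, he2.trans he3⟩
      · intro u hu
        obtain ⟨hu1, hu2⟩ := (hLf v u).1 hu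
        exact List.mem_reverse.2 (List.mem_map.2 ⟨(u, v), (hImem _).2
          ⟨(hw _).2 ⟨hu1.symm, hbefore u hu2, hv⟩, rfl⟩, rfl⟩)
    have hIprod : (I.map fun e => μ e.1 e.2).prod = ((Rt v).map (μ v)).prod := by
      have h1 := htriv v hv
      rw [List.map_append, List.prod_append] at h1
      rw [eq_inv_of_mul_eq_one_left h1, List.prod_inv_reverse, ← hIrev, List.map_map,
        List.map_reverse, List.reverse_reverse, List.map_map]
      refine congrArg _ (List.map_congr_left fun e he => ?_)
      rw [← ((hImem e).1 he).2]
      exact hμ e.2 e.1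
    have hnext := ih _ ?_ t' ?_ (fun u hu => htriv u (hv.trans (hvt'.trans hu)))
      (A ++ (Rt v).map (fun u => (v, u)) ++ B) ?_ ?_ rfl
    · rw [hsplit]
      rw [List.map_append, List.map_append, List.prod_append, List.prod_append, List.map_map]
        at hnext
      rw [List.map_append, List.map_append, List.prod_append, List.prod_append, hIprod]
      exact hnext
    · rw [← hn]
      refine Finset.card_lt_card ⟨fun u hu => ?_, fun hsub => ?_⟩
      · simp only [Finset.mem_filter, Finset.mem_univ, true_and] at hu ⊢
        exact hv.trans (hvt'.trans hu)
      · have := hsub (by simpa using hv : v ∈ _)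
        simp only [Finset.mem_filter, Finset.mem_univ, true_and] at this
        exact this.not_gt hvt'
    · intro u hu
      exact (ht' u (hu ▸ hvt')).ne' hu
    · intro e
      have hABmem : e ∈ A ∨ e ∈ B ↔ e ∈ w ∧ e.2 ≠ v := by
        constructor
        · rintro (he | he)
          · exact hAv e he
          · exact hBv e he
        · rintro ⟨he, hev⟩
          rcases lt_or_gt_of_ne (mt (hendv e he).1 hev) with hlt | hlt
          · exact Or.inl ((hAmem e).2 ⟨he, hlt⟩)
          · exact Or.inr ((hBmem e).2 ⟨he, hlt⟩)
      have : e ∈ A ++ (Rt v).map (fun u => (v, u)) ++ B ↔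
          (e ∈ w ∧ e.2 ≠ v) ∨ ∃ u ∈ Rt v, (v, u) = e := by
        rw [← hABmem]
        simp only [List.mem_append, List.mem_map]
        exact or_right_comm
      rw [this]
      constructor
      · rintro (⟨he, hev⟩ | ⟨u, hu, rfl⟩)
        · obtain ⟨he1, he2, -⟩ := (hw e).1 he
          exact ⟨he1, he2.trans (hv.trans hvt'), hend e he hev⟩
        · obtain ⟨hu1, hu2⟩ := (hRt v u).1 hu
          exact ⟨hu1, hvt', ht' u hu2⟩
      · rintro ⟨he1, he2, he3⟩
        have hv2 : x v < x e.2 := hvt'.trans he3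
        rcases (hafter _ he2).lt_or_eq with hlt | heq
        · refine Or.inl ⟨(hw e).2 ⟨he1, hbefore _ hlt, hv.trans hv2⟩, ?_⟩
          rintro rfl
          exact lt_irrefl _ hv2
        · obtain rfl := h.inj heq
          exact Or.inr ⟨e.2, (hRt _ _).2 ⟨he1, hv2⟩, rfl⟩
    · have hno : ∀ u, x v < x u → ¬ x u < t' := fun u hu => (ht' u hu).not_gt
      have hcmp : ∀ a b c d, G.Adj a b → G.Adj c d → x a ≤ x v → t' < x b → x c ≤ x v →
          t' < x d → heightAt x y a b (x v) < heightAt x y c d (x v) →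
          heightAt x y a b t' < heightAt x y c d t' := fun a b c d hab hcd h1 h2 h3 h4 hlt =>
        h.heightAt_lt hab hcd hvt' h1 h2 h3 h4 hno hlt
      have hold : ∀ e ∈ w, e.2 ≠ v → ∀ e' ∈ w, e'.2 ≠ v →
          heightAt x y e.1 e.2 t < heightAt x y e'.1 e'.2 t →
          heightAt x y e.1 e.2 t' < heightAt x y e'.1 e'.2 t' := by
        intro e he hev e' he' hev' hlt
        obtain ⟨he1, he2, he3⟩ := (hw e).1 he
        obtain ⟨he1', he2', he3'⟩ := (hw e').1 he'
        have hve := hend e he hev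
        have hve' := hend e' he' hev'
        refine hcmp _ _ _ _ he1 he1' (he2.trans hv).le hve (he2'.trans hv).le hve' ?_
        exact h.heightAt_lt he1 he1' hv he2.le (hvt'.trans hve) he2'.le (hvt'.trans hve')
          (fun u hu => (hmin u hu).not_gt) hlt
      have hws' := hws
      rw [hsplit, List.pairwise_append, List.pairwise_append] at hws'
      obtain ⟨⟨hsA, -, -⟩, hsB, hsAB⟩ := hws'
      rw [List.pairwise_append, List.pairwise_append]
      refine ⟨⟨?_, ?_, ?_⟩, ?_, ?_⟩
      · exact hsA.imp_of_mem fun {e e'} he he' hlt =>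
          hold e (hAv e he).1 (hAv e he).2 e' (hAv e' he').1 (hAv e' he').2 hlt
      · rw [List.pairwise_map]
        exact (hRs v).imp fun hlt => (heightAt_lt_heightAt_iff hvt').2 hlt
      · intro e he e' he'
        obtain ⟨u, hu, rfl⟩ := List.mem_map.1 he'
        obtain ⟨hu1, hu2⟩ := (hRt v u).1 hu
        obtain ⟨hew, hev⟩ := hAv e he
        obtain ⟨he1, he2, he3⟩ := (hw e).1 hew
        refine hcmp _ _ _ _ he1 hu1 (he2.trans hv).le (hend e hew hev) le_rfl (ht' u hu2) ?_
        rw [heightAt_left]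
        exact ((hAmem e).1 he).2
      · exact hsB.imp_of_mem fun {e e'} he he' hlt =>
          hold e (hBv e he).1 (hBv e he).2 e' (hBv e' he').1 (hBv e' he').2 hlt
      · intro e he e' he'
        obtain ⟨hew', hev'⟩ := hBv e' he'
        obtain ⟨he1', he2', he3'⟩ := (hw e').1 hew'
        rcases List.mem_append.1 he with he | he
        · exact hold e (hAv e he).1 (hAv e he).2 e' hew' hev'
            (hsAB e (List.mem_append_left _ he) e' he')
        · obtain ⟨u, hu, rfl⟩ := List.mem_map.1 he
          obtain ⟨hu1, hu2⟩ := (hRt v u).1 hu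
          refine hcmp _ _ _ _ hu1 he1' le_rfl (ht' u hu2) (he2'.trans hv).le (hend e' hew' hev') ?_
          rw [heightAt_left]
          exact ((hBmem e').1 he').2

theorem IsGenericDrawing.exists_bounds [Fintype V] [Nonempty V] (h : IsGenericDrawing G x y) :
    ∃ (rot : V → List V) (r : V), IsRotation G rot ∧
      Bounds rot {v | v ≠ r} ((rot r).map fun u => (r, u)) := by
  classical
  have hR : ∀ v, ∃ l : List V, (∀ u, u ∈ l ↔ G.Adj v u ∧ x v < x u) ∧
      l.Pairwise (slopeAt x y v · < slopeAt x y v ·) := by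
    intro v
    obtain ⟨l, hl, hl'⟩ := exists_sorted_list
      (Finset.univ.filter fun u => G.Adj v u ∧ x v < x u) (slopeAt x y v)
      ((h.slopeAt_injOn_right v).mono fun u hu => by simpa using hu)
    exact ⟨l, by simpa using hl, hl'⟩
  have hL : ∀ v, ∃ l : List V, (∀ u, u ∈ l ↔ G.Adj v u ∧ x u < x v) ∧
      l.Pairwise (slopeAt x y v · < slopeAt x y v ·) := by
    intro v
    obtain ⟨l, hl, hl'⟩ := exists_sorted_list
      (Finset.univ.filter fun u => G.Adj v u ∧ x u < x v) (slopeAt x y v)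
      ((h.slopeAt_injOn_left v).mono fun u hu => by simpa using hu)
    exact ⟨l, by simpa using hl, hl'⟩
  choose Rt hRt hRs using hR
  choose Lf hLf hLs using hL
  obtain ⟨r, -, hr⟩ := Finset.exists_min_image Finset.univ x Finset.univ_nonempty
  obtain ⟨t, hrt, ht⟩ := exists_between_next x (x r)
  have hLr : Lf r = [] := List.eq_nil_iff_forall_not_mem.2 fun u hu =>
    ((hLf r u).1 hu).2.not_ge (hr u (Finset.mem_univ _))
  have hbefore : ∀ u, x u < t → u = r := fun u hu =>
    h.inj (le_antisymm (not_lt.1 fun h' => (ht u h').not_gt hu) (hr u (Finset.mem_univ _)))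
  refine ⟨fun v => Rt v ++ Lf v, r, ⟨fun v => ?_, fun v u => ?_⟩, fun μ hμ htriv => ?_⟩
  · refine List.Nodup.append ((hRs v).imp fun h e => ?_) ((hLs v).imp fun h e => ?_) ?_
    · exact lt_irrefl _ (e ▸ h)
    · exact lt_irrefl _ (e ▸ h)
    · exact fun u hu hu' => (((hRt v u).1 hu).2.trans ((hLf v u).1 hu').2).false
  · rw [List.mem_append, hRt, hLf, ← and_or_left]
    exact and_iff_left_of_imp fun huv => lt_or_gt_of_ne (h.inj.ne huv.ne)
  · change (List.map _ (List.map _ (Rt r ++ Lf r))).prod = 1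
    rw [hLr, List.append_nil]
    refine h.sweep hRt hRs hLf hLs hμ t (fun v hv => ?_) (fun v hv => htriv v ?_) _ (fun e => ?_) ?_
    · by_cases hvr : x r < x v
      · exact (ht v hvr).ne' hv
      · exact hvr (hv ▸ hrt)
    · rintro rfl
      exact hv.not_gt hrt
    · rw [List.mem_map]
      constructor
      · rintro ⟨u, hu, rfl⟩
        obtain ⟨hu1, hu2⟩ := (hRt r u).1 hu
        exact ⟨hu1, hrt, ht u hu2⟩
      · rintro ⟨he1, he2, he3⟩
        obtain rfl := hbefore _ he2
        exact ⟨e.2, (hRt _ _).2 ⟨he1, he2.trans he3⟩, rfl⟩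
    · rw [List.pairwise_map]
      exact (hRs r).imp fun hlt => (heightAt_lt_heightAt_iff hrt).2 hlt

end Sweep

end MonotoneGrid

/-- There is a constant `C > 0` such that every connected planar
graph on `n ≥ 1` vertices has a spanning tree `T` and a monotone grid drawing on
`[0, C·n] × [0, C·n²]` in which every pair of distinct vertices is joined by a
monotone path all of whose edges are edges of `T`. -/
theorem monotone_grid_drawing_through_spanning_tree :
    ∃ C : ℝ, 0 < C ∧
      ∀ (V : Type) (_ : Fintype V) (G : SimpleGraph V),
        1 ≤ Fintype.card V →
        G.Connected →
        (∃ f : V → ℝ × ℝ, IsPlanarDrawing G f) →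
        ∃ (T : SimpleGraph V) (g : V → ℤ × ℤ),
          T ≤ G ∧ T.IsTree ∧
          IsMonotoneDrawing G (gridMap g) ∧
          (∀ v : V,
            0 ≤ (g v).1 ∧ ((g v).1 : ℝ) ≤ C * (Fintype.card V : ℝ) ∧
            0 ≤ (g v).2 ∧ ((g v).2 : ℝ) ≤ C * (Fintype.card V : ℝ) ^ 2) ∧
          (∀ a b : V, a ≠ b →
            ∃ w : T.Walk a b, w.IsPath ∧ MonotoneWalk (gridMap g) w) := by
  refine ⟨1, one_pos, fun V _ G _ hG hf => ?_⟩
  obtain ⟨f, hf⟩ := hf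
  have := hG.nonempty
  obtain ⟨x, y, hxy⟩ := MonotoneGrid.exists_isGenericDrawing hf
  obtain ⟨rot, r, hrot, hr⟩ := hxy.exists_bounds
  exact MonotoneGrid.exists_drawing_of_bounds hG hrot hr
end

section
/- Let T be a finite tree on n ≥ 2 vertices. Then T admits a monotone grid drawing f : V → ℤ² in which every vertex is placed at a grid point (x, y) with 0 ≤ x ≤ n and 0 ≤ y ≤ n². -/
open SimpleGraph

namespace SimpleGraph

/-- `L v` lists the vertices of the path from a fixed root to `v`, for every vertex `v`. -/
structure IsRootPathSystem {V : Type} (G : SimpleGraph V) (L : V → List V) : Prop where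
  ends_at : ∀ v, ∃ q, L v = q ++ [v]
  starts_at_root : ∃ r, ∀ v, ∃ q, L v = r :: q
  nodup : ∀ v, (L v).Nodup
  adj : ∀ a b, G.Adj a b → L b = L a ++ [b] ∨ L a = L b ++ [a]
  parent : ∀ u q, q ≠ [] → L u = q ++ [u] → ∃ v, G.Adj v u ∧ L v = q

theorem IsTree.exists_isRootPathSystem {V : Type} {G : SimpleGraph V} (hG : G.IsTree) :
    ∃ L : V → List V, G.IsRootPathSystem L := by
  obtain ⟨r⟩ := hG.connected.nonempty
  choose P hP hu using hG.existsUnique_path r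
  refine ⟨fun v => (P v).support, fun v => ⟨_, (P v).dropLast_support_concat.symm⟩,
    ⟨r, fun v => ⟨_, (P v).cons_tail_support.symm⟩⟩, fun v => (hP v).support_nodup, ?_, ?_⟩
  · intro a b hab
    by_cases h : a ∈ (P b).support
    · left
      rw [hG.isAcyclic.path_concat (hP a) (hP b) hab h, Walk.support_concat]
    · right
      have h' := hG.isAcyclic.mem_support_of_ne_mem_support_of_adj_of_isPath (hP a) (hP b) hab h
      rw [hG.isAcyclic.path_concat (hP b) (hP a) hab.symm h', Walk.support_concat]
  · intro u q hq h
    have hnil : ¬ (P u).Nil := by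
      intro hn
      have hlen := congrArg List.length h
      rw [Walk.length_support, List.length_append, Walk.length_eq_zero_iff.mpr hn] at hlen
      exact hq (List.length_eq_zero_iff.mp (by simpa using hlen))
    refine ⟨(P u).penultimate, (P u).adj_penultimate hnil, ?_⟩
    rw [← hu _ _ (hP u).dropLast, Walk.support_dropLast hnil, h, List.dropLast_concat]

end SimpleGraph

/-- A lexicographic comparison is either a prefix relation or decided at a first difference. -/
theorem List.prefix_or_diverge_of_lt {α : Type*} [LinearOrder α] {l₁ l₂ : List α} (h : l₁ < l₂) :
    (∃ s, l₂ = l₁ ++ s) ∨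
      ∃ p a b s t, l₁ = p ++ a :: s ∧ l₂ = p ++ b :: t ∧ a < b := by
  induction l₁ generalizing l₂ with
  | nil => exact Or.inl ⟨l₂, rfl⟩
  | cons x l ih =>
    cases l₂ with
    | nil => simp at h
    | cons y m =>
      rcases List.cons_lt_cons_iff.mp h with hxy | ⟨rfl, hlm⟩
      · exact Or.inr ⟨[], x, y, l, m, rfl, rfl, hxy⟩
      · rcases ih hlm with ⟨s, rfl⟩ | ⟨p, a, b, s, t, rfl, rfl, hab⟩
        · exact Or.inl ⟨s, rfl⟩
        · exact Or.inr ⟨x :: p, a, b, s, t, rfl, rfl, hab⟩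

theorem List.append_cons_lt_append_cons {α : Type*} [LinearOrder α] (p : List α) {a b : α}
    (s t : List α) (hab : a < b) : p ++ a :: s < p ++ b :: t :=
  List.append_left_lt (List.cons_lt_cons_iff.mpr (Or.inl hab))

namespace SimpleGraph.IsRootPathSystem

variable {V : Type} {G : SimpleGraph V} {L : V → List V}

theorem injective (hL : G.IsRootPathSystem L) : Function.Injective L := by
  intro u v h
  obtain ⟨q, hq⟩ := hL.ends_at u
  obtain ⟨q', hq'⟩ := hL.ends_at v
  rw [hq, hq'] at h
  simpa using (List.append_inj' h rfl).2

theorem eq_of_eq_append (hL : G.IsRootPathSystem L) {u : V} :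
    ∀ {s q : List V} {x : V}, L u = q ++ x :: s → L x = q ++ [x] := by
  intro s
  induction s using List.reverseRecOn generalizing u with
  | nil =>
    intro q x h
    obtain ⟨q', hq'⟩ := hL.ends_at u
    obtain rfl : u = x := by
      rw [hq'] at h
      simpa using (List.append_inj' h rfl).2
    exact h
  | append_singleton s y ih =>
    intro q x h
    obtain ⟨q', hq'⟩ := hL.ends_at u
    have h' : q' = q ++ x :: s := by
      rw [hq', ← List.cons_append, ← List.append_assoc] at h
      exact (List.append_inj' h rfl).1
    obtain ⟨v, -, hv⟩ := hL.parent u q' (by simp [h']) hq'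
    exact ih (hv.trans h')

theorem exists_eq_prefix (hL : G.IsRootPathSystem L) {u : V} {p s : List V} (hp : p ≠ [])
    (h : L u = p ++ s) : ∃ w, L w = p := by
  obtain ⟨q, x, rfl⟩ := List.eq_nil_or_concat p |>.resolve_left hp
  refine ⟨x, ?_⟩
  rw [List.concat_eq_append, List.append_assoc] at h
  simpa using hL.eq_of_eq_append h

end SimpleGraph.IsRootPathSystem

section Drawing

variable {V : Type} [Fintype V] [LinearOrder V] {G : SimpleGraph V} {L : V → List V}

/-- The number of vertices preceding `v` in the depth-first order given by the root paths `L`. -/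
def preorderRank (L : V → List V) (v : V) : ℤ :=
  (Finset.univ.filter fun u => L u < L v).card

/-- The drawing in which the edge from the parent of `v` to `v` is the vector
`(1, preorderRank L v)`. -/
def preorderDrawing (L : V → List V) (v : V) : ℤ × ℤ :=
  ((L v).length, ((L v).map (preorderRank L)).sum)

theorem preorderRank_nonneg (v : V) : 0 ≤ preorderRank L v := Int.natCast_nonneg _

theorem preorderRank_le_card (v : V) : preorderRank L v ≤ Fintype.card V := by
  unfold preorderRank
  exact_mod_cast Finset.card_le_univ _

theorem preorderRank_mono {u v : V} (h : L u ≤ L v) : preorderRank L u ≤ preorderRank L v := by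
  unfold preorderRank
  exact_mod_cast Finset.card_le_card fun x hx => by
    simp only [Finset.mem_filter, Finset.mem_univ, true_and] at hx ⊢
    exact hx.trans_le h

theorem preorderRank_strictMono {u v : V} (h : L u < L v) :
    preorderRank L u < preorderRank L v := by
  unfold preorderRank
  refine Int.ofNat_lt.mpr (Finset.card_lt_card ?_)
  rw [Finset.ssubset_iff_of_subset]
  · exact ⟨u, by simpa using h, by simp⟩
  · intro x hx
    simp only [Finset.mem_filter, Finset.mem_univ, true_and] at hx ⊢
    exact hx.trans h

namespace SimpleGraph.IsRootPathSystem

theorem preorderRank_lt_of_mem_branch (hL : G.IsRootPathSystem L) {u v a b : V}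
    {p s t : List V} (hu : L u = p ++ a :: s) (hv : L v = p ++ b :: t) (hab : a < b) :
    ∀ x ∈ a :: s, preorderRank L x < preorderRank L b := by
  intro x hx
  refine preorderRank_strictMono ?_
  rw [hL.eq_of_eq_append hv]
  obtain ⟨s₁, s₂, h⟩ := List.append_of_mem hx
  rw [h, ← List.append_assoc] at hu
  rw [hL.eq_of_eq_append hu]
  cases s₁ with
  | nil =>
    obtain ⟨rfl, -⟩ := List.cons_eq_cons.mp h
    simpa using List.append_cons_lt_append_cons p [] [] hab
  | cons y s₁ =>
    obtain ⟨rfl, -⟩ := List.cons_eq_cons.mp h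
    simpa using List.append_cons_lt_append_cons p (s₁ ++ [x]) [] hab

theorem preorderRank_le_of_mem_branch (hL : G.IsRootPathSystem L) {v b : V}
    {p t : List V} (hv : L v = p ++ b :: t) :
    ∀ x ∈ b :: t, preorderRank L b ≤ preorderRank L x := by
  intro x hx
  refine preorderRank_mono ?_
  have hb := hL.eq_of_eq_append hv
  obtain ⟨s₁, s₂, h⟩ := List.append_of_mem hx
  rw [h, ← List.append_assoc] at hv
  rw [hb, hL.eq_of_eq_append hv]
  cases s₁ with
  | nil =>
    obtain ⟨rfl, -⟩ := List.cons_eq_cons.mp h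
    simp
  | cons y s₁ =>
    obtain ⟨rfl, -⟩ := List.cons_eq_cons.mp h
    rw [List.append_assoc]
    refine (List.append_left_lt ?_).le
    exact List.cons_lt_cons_self.mpr (by cases s₁ <;> simp)

theorem preorderDrawing_snd_lt (hL : G.IsRootPathSystem L) {u v : V}
    (hlen : (L u).length = (L v).length) (h : L u < L v) :
    (preorderDrawing L u).2 < (preorderDrawing L v).2 := by
  rcases List.prefix_or_diverge_of_lt h with ⟨s, hs⟩ | ⟨p, a, b, s, t, hu, hv, hab⟩
  · have : s = [] := by
      rw [hs, List.length_append] at hlen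
      exact List.length_eq_zero_iff.mp (by omega)
    simp [this] at hs
    exact absurd h (by simp [hs])
  · have h₁ := List.sum_le_card_nsmul ((a :: s).map (preorderRank L)) (preorderRank L b - 1) (by
      intro y hy
      obtain ⟨x, hx, rfl⟩ := List.mem_map.mp hy
      have := hL.preorderRank_lt_of_mem_branch hu hv hab x hx
      omega)
    have h₂ := List.card_nsmul_le_sum ((b :: t).map (preorderRank L)) (preorderRank L b) (by
      intro y hy
      obtain ⟨x, hx, rfl⟩ := List.mem_map.mp hy
      exact hL.preorderRank_le_of_mem_branch hv x hx)
    have hst : s.length = t.length := by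
      simpa [hu, hv] using hlen
    simp only [preorderDrawing, hu, hv, List.map_append, List.sum_append]
    simp only [List.length_map, List.length_cons, nsmul_eq_mul, hst] at h₁ h₂
    push_cast at h₁ h₂
    nlinarith

theorem preorderDrawing_injective (hL : G.IsRootPathSystem L) :
    Function.Injective (preorderDrawing L) := by
  intro u v h
  have hlen : (L u).length = (L v).length := by
    simpa [preorderDrawing] using congrArg Prod.fst h
  by_contra huv
  rcases lt_or_gt_of_ne (hL.injective.ne huv) with h' | h'
  · exact (hL.preorderDrawing_snd_lt hlen h').ne (congrArg Prod.snd h)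
  · exact (hL.preorderDrawing_snd_lt hlen.symm h').ne' (congrArg Prod.snd h)

end SimpleGraph.IsRootPathSystem

theorem gridMap_injective {W : Type} {g : W → ℤ × ℤ} (hg : Function.Injective g) :
    Function.Injective (gridMap g) := by
  intro u v h
  simp only [gridMap, Prod.mk.injEq, Int.cast_inj] at h
  exact hg (Prod.ext h.1 h.2)

theorem gridMap_preorderDrawing_child {u v : V} (h : L u = L v ++ [u]) :
    gridMap (preorderDrawing L) u =
      gridMap (preorderDrawing L) v + (1, (preorderRank L u : ℝ)) := by
  ext <;> simp [gridMap, preorderDrawing, h]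

theorem exists_param_of_mem_segment_child {u v : V} (h : L u = L v ++ [u]) {p : ℝ × ℝ}
    (hp : p ∈ segment ℝ (gridMap (preorderDrawing L) v) (gridMap (preorderDrawing L) u)) :
    ∃ t : ℝ, 0 ≤ t ∧ t ≤ 1 ∧
      p = gridMap (preorderDrawing L) v + t • (1, (preorderRank L u : ℝ)) := by
  rw [segment_eq_image'] at hp
  obtain ⟨t, ⟨h0, h1⟩, rfl⟩ := hp
  exact ⟨t, h0, h1, by simp [gridMap_preorderDrawing_child h]⟩

namespace SimpleGraph.IsRootPathSystem

theorem common_endpoint_of_same_depth (hL : G.IsRootPathSystem L) {v c v' c' : V}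
    (hc : L c = L v ++ [c]) (hc' : L c' = L v' ++ [c'])
    (hlen : (L v).length = (L v').length) (hlt : L c < L c') {t : ℝ} (h0 : 0 ≤ t) (h1 : t ≤ 1)
    (hp : (gridMap (preorderDrawing L) v + t • (1, (preorderRank L c : ℝ)) : ℝ × ℝ) =
      gridMap (preorderDrawing L) v' + t • (1, (preorderRank L c' : ℝ))) :
    t = 0 ∧ v = v' := by
  have hle : L v ≤ L v' := by
    by_contra! h
    rcases List.prefix_or_diverge_of_lt h with ⟨s, hs⟩ | ⟨p, a, b, s, t, hu, hv, hab⟩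
    · have : s = [] := by
        rw [hs, List.length_append] at hlen
        exact List.length_eq_zero_iff.mp (by omega)
      simp [this] at hs
      exact absurd h (by simp [hs])
    · refine absurd hlt (not_lt.mpr ?_)
      rw [hc, hc', hu, hv, List.append_assoc, List.append_assoc]
      exact (List.append_cons_lt_append_cons p _ _ hab).le
  have hyv : (preorderDrawing L v).2 ≤ (preorderDrawing L v').2 := by
    rcases hle.eq_or_lt with h | h
    · rw [hL.injective h]
    · exact (hL.preorderDrawing_snd_lt hlen h).le
  have hyc := hL.preorderDrawing_snd_lt (by simp [hc, hc', hlen]) hlt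
  have e₁ : (preorderDrawing L c).2 = (preorderDrawing L v).2 + preorderRank L c := by
    simp [preorderDrawing, hc]
  have e₂ : (preorderDrawing L c').2 = (preorderDrawing L v').2 + preorderRank L c' := by
    simp [preorderDrawing, hc']
  rw [e₁, e₂] at hyc
  have hy := congrArg Prod.snd hp
  simp only [gridMap, Prod.snd_add, Prod.smul_snd, smul_eq_mul] at hy
  have hyv' : ((preorderDrawing L v).2 : ℝ) ≤ (preorderDrawing L v').2 := by exact_mod_cast hyv
  have hyc' : ((preorderDrawing L v).2 + preorderRank L c : ℝ) <
      (preorderDrawing L v').2 + preorderRank L c' := by exact_mod_cast hyc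
  have ht : t = 0 := by
    by_contra hne
    have hpos : 0 < t := lt_of_le_of_ne h0 (Ne.symm hne)
    nlinarith [mul_nonneg (sub_nonneg.mpr h1) (sub_nonneg.mpr hyv'),
      mul_pos hpos (sub_pos.mpr hyc')]
  refine ⟨ht, gridMap_injective hL.preorderDrawing_injective ?_⟩
  simpa [ht] using hp

theorem common_endpoint_of_mem_segments (hL : G.IsRootPathSystem L) {v c v' c' : V}
    (hc : L c = L v ++ [c]) (hc' : L c' = L v' ++ [c']) (hne : c ≠ c') {p : ℝ × ℝ}
    (hp : p ∈ segment ℝ (gridMap (preorderDrawing L) v) (gridMap (preorderDrawing L) c))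
    (hp' : p ∈ segment ℝ (gridMap (preorderDrawing L) v') (gridMap (preorderDrawing L) c')) :
    ∃ x : V, (x = v ∨ x = c) ∧ (x = v' ∨ x = c') ∧ p = gridMap (preorderDrawing L) x := by
  wlog hle : (L v).length ≤ (L v').length generalizing v c v' c'
  · obtain ⟨x, h₁, h₂, h₃⟩ := this hc' hc hne.symm hp' hp (le_of_not_ge hle)
    exact ⟨x, h₂, h₁, h₃⟩
  obtain ⟨t, h0, h1, ht⟩ := exists_param_of_mem_segment_child hc hp
  obtain ⟨t', h0', h1', ht'⟩ := exists_param_of_mem_segment_child hc' hp'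
  have hx := congrArg Prod.fst (ht.symm.trans ht')
  simp only [gridMap, preorderDrawing, Prod.fst_add, Prod.smul_fst, smul_eq_mul, mul_one,
    Int.cast_natCast] at hx
  rcases hle.eq_or_lt with hlen | hlen
  · obtain rfl : t = t' := by
      rw [hlen] at hx
      linarith
    rcases lt_or_gt_of_ne (hL.injective.ne hne) with hlt | hlt
    · obtain ⟨rfl, rfl⟩ := hL.common_endpoint_of_same_depth hc hc' hlen hlt h0 h1
        (ht.symm.trans ht')
      exact ⟨v, Or.inl rfl, Or.inl rfl, by simpa using ht⟩
    · obtain ⟨rfl, rfl⟩ := hL.common_endpoint_of_same_depth hc' hc hlen.symm hlt h0 h1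
        (ht'.symm.trans ht)
      exact ⟨v', Or.inl rfl, Or.inl rfl, by simpa using ht⟩
  · have hlen' : ((L v).length : ℝ) + 1 ≤ (L v').length := by exact_mod_cast hlen
    obtain rfl : t = 1 := by linarith
    obtain rfl : t' = 0 := by linarith
    rw [one_smul, ← gridMap_preorderDrawing_child hc] at ht
    rw [zero_smul, add_zero] at ht'
    have := gridMap_injective hL.preorderDrawing_injective (ht.symm.trans ht')
    exact ⟨c, Or.inr rfl, Or.inl this, ht⟩

theorem notMem_openSegment_child {v c : V} (hc : L c = L v ++ [c]) (w : V) :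
    gridMap (preorderDrawing L) w ∉
      openSegment ℝ (gridMap (preorderDrawing L) v) (gridMap (preorderDrawing L) c) := by
  rw [openSegment_eq_image', gridMap_preorderDrawing_child hc]
  rintro ⟨t, ⟨h0, h1⟩, ht⟩
  have hx := congrArg Prod.fst ht
  simp only [gridMap, preorderDrawing, add_sub_cancel_left, Prod.fst_add, Prod.smul_fst,
    smul_eq_mul, mul_one, Int.cast_natCast] at hx
  have h₁ : ((L v).length : ℝ) < (L w).length := by linarith
  have h₂ : ((L w).length : ℝ) < (L v).length + 1 := by linarith
  norm_cast at h₁ h₂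
  omega

theorem isPlanarDrawing (hL : G.IsRootPathSystem L) :
    IsPlanarDrawing G (gridMap (preorderDrawing L)) := by
  refine ⟨gridMap_injective hL.preorderDrawing_injective, ?_, ?_⟩
  · intro a b c d hab hcd hne p hp hp'
    have key : ∀ {v c v' c' : V}, L c = L v ++ [c] → L c' = L v' ++ [c'] →
        s(v, c) ≠ s(v', c') → c ≠ c' := by
      rintro v c v' c' hc hc' h rfl
      rw [hc] at hc'
      exact h (by rw [hL.injective (List.append_inj' hc' rfl).1])
    rcases hL.adj a b hab with h | h <;> rcases hL.adj c d hcd with h' | h'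
    · exact hL.common_endpoint_of_mem_segments h h' (key h h' hne) hp hp'
    · rw [segment_symm] at hp'
      rw [Sym2.eq_swap (a := c)] at hne
      obtain ⟨x, h₁, h₂, h₃⟩ := hL.common_endpoint_of_mem_segments h h' (key h h' hne) hp hp'
      exact ⟨x, h₁, h₂.symm, h₃⟩
    · rw [segment_symm] at hp
      rw [Sym2.eq_swap (a := a)] at hne
      obtain ⟨x, h₁, h₂, h₃⟩ := hL.common_endpoint_of_mem_segments h h' (key h h' hne) hp hp'
      exact ⟨x, h₁.symm, h₂, h₃⟩
    · rw [segment_symm] at hp hp'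
      rw [Sym2.eq_swap (a := a), Sym2.eq_swap (a := c)] at hne
      obtain ⟨x, h₁, h₂, h₃⟩ := hL.common_endpoint_of_mem_segments h h' (key h h' hne) hp hp'
      exact ⟨x, h₁.symm, h₂.symm, h₃⟩
  · intro a b c hab _ _
    rcases hL.adj a b hab with h | h
    · exact notMem_openSegment_child h c
    · rw [openSegment_symm]
      exact notMem_openSegment_child h c

end SimpleGraph.IsRootPathSystem

/-- An edge of `G` that makes progress in direction `d`. -/
def MonotoneStep {W : Type} (G : SimpleGraph W) (f : W → ℝ × ℝ) (d : ℝ × ℝ) (x y : W) : Prop :=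
  G.Adj x y ∧ 0 < dot (f y - f x) d

theorem MonotoneStep.reverse {W : Type} {H : SimpleGraph W} {f : W → ℝ × ℝ} {d : ℝ × ℝ} {x y : W}
    (h : MonotoneStep H f (-d) x y) : MonotoneStep H f d y x := by
  refine ⟨h.1.symm, ?_⟩
  have := h.2
  simp only [dot, Prod.fst_sub, Prod.snd_sub, Prod.fst_neg, Prod.snd_neg] at this ⊢
  linarith

theorem reflTransGen_monotoneStep_reverse {W : Type} {H : SimpleGraph W} {f : W → ℝ × ℝ}
    {d : ℝ × ℝ} {x y : W} (h : Relation.ReflTransGen (MonotoneStep H f (-d)) x y) :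
    Relation.ReflTransGen (MonotoneStep H f d) y x := by
  induction h with
  | refl => exact .refl
  | tail _ hstep ih => exact .head hstep.reverse ih

theorem exists_monotone_path_of_reflTransGen {W : Type} {H : SimpleGraph W} {f : W → ℝ × ℝ}
    {d : ℝ × ℝ} (hd : d ≠ 0) {a b : W} (h : Relation.ReflTransGen (MonotoneStep H f d) a b) :
    ∃ w : H.Walk a b, w.IsPath ∧ MonotoneWalk f w := by
  suffices hw : ∃ w : H.Walk a b, w.support.IsChain fun x y => 0 < dot (f y - f x) d by
    obtain ⟨w, hw⟩ := hw
    refine ⟨w, ?_, d, hd, hw⟩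
    rw [Walk.isPath_def]
    have hw' : w.support.IsChain fun x y => dot (f x) d < dot (f y) d := by
      refine hw.imp fun x y hxy => ?_
      simp only [dot, Prod.fst_sub, Prod.snd_sub] at hxy ⊢
      linarith
    have : IsTrans W fun x y => dot (f x) d < dot (f y) d := ⟨fun _ _ _ => lt_trans⟩
    exact hw'.pairwise.imp fun {x y} hxy he => by simp [he] at hxy
  induction h using Relation.ReflTransGen.head_induction_on with
  | refl => exact ⟨.nil, by simp⟩
  | head hstep _ ih =>
    obtain ⟨w, hw⟩ := ih
    refine ⟨.cons hstep.1 w, ?_⟩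
    rw [← w.cons_tail_support] at hw
    rw [Walk.support_cons, ← w.cons_tail_support]
    exact hw.cons_cons hstep.2

namespace SimpleGraph.IsRootPathSystem

theorem reflTransGen_monotoneStep_of_prefix (hL : G.IsRootPathSystem L) {d : ℝ × ℝ} {v : V} :
    ∀ {s : List V} {u : V}, L u = L v ++ s → (∀ x ∈ s, 0 < dot (1, (preorderRank L x : ℝ)) d) →
      Relation.ReflTransGen (MonotoneStep G (gridMap (preorderDrawing L)) d) v u := by
  intro s
  induction s using List.reverseRecOn with
  | nil =>
    intro u h _
    rw [List.append_nil] at h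
    rw [hL.injective h]
  | append_singleton s y ih =>
    intro u h hs
    rw [← List.append_assoc] at h
    obtain ⟨q, hq⟩ := hL.ends_at u
    obtain ⟨rfl, hy⟩ := List.append_inj' (hq.symm.trans h) rfl
    obtain rfl : u = y := by simpa using hy
    obtain ⟨q', hq'⟩ := hL.ends_at v
    obtain ⟨w, hw, hwq⟩ := hL.parent u _ (by simp [hq']) h
    refine (ih hwq fun x hx => hs x (by simp [hx])).tail ⟨hw, ?_⟩
    rw [gridMap_preorderDrawing_child (h.trans (by rw [hwq])), add_sub_cancel_left]
    exact hs u (by simp)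

theorem exists_reflTransGen_monotoneStep_of_lt (hL : G.IsRootPathSystem L) {u v : V}
    (h : L u < L v) :
    ∃ d : ℝ × ℝ, d ≠ 0 ∧
      Relation.ReflTransGen (MonotoneStep G (gridMap (preorderDrawing L)) d) u v := by
  rcases List.prefix_or_diverge_of_lt h with ⟨s, hs⟩ | ⟨p, a, b, s, t, hu, hv, hab⟩
  · exact ⟨(1, 0), by simp, hL.reflTransGen_monotoneStep_of_prefix hs (by simp [dot])⟩
  · have hp : p ≠ [] := by
      rintro rfl
      obtain ⟨r, hr⟩ := hL.starts_at_root
      obtain ⟨q, hq⟩ := hr u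
      obtain ⟨q', hq'⟩ := hr v
      rw [hq] at hu
      rw [hq'] at hv
      simp only [List.nil_append, List.cons.injEq] at hu hv
      exact hab.ne (hu.1.symm.trans hv.1)
    obtain ⟨w, hw⟩ := hL.exists_eq_prefix hp hu
    refine ⟨(-(preorderRank L b - 1 / 2 : ℝ), 1), by simp, .trans (b := w) ?_ ?_⟩
    · refine reflTransGen_monotoneStep_reverse
        (hL.reflTransGen_monotoneStep_of_prefix (hu.trans (by rw [hw])) ?_)
      intro x hx
      have hlt : preorderRank L x + 1 ≤ preorderRank L b :=
        hL.preorderRank_lt_of_mem_branch hu hv hab x hx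
      have hlt' : (preorderRank L x : ℝ) + 1 ≤ preorderRank L b := by exact_mod_cast hlt
      simp only [dot, Prod.fst_neg, Prod.snd_neg]
      linarith
    · refine hL.reflTransGen_monotoneStep_of_prefix (hv.trans (by rw [hw])) ?_
      intro x hx
      have hle' : (preorderRank L b : ℝ) ≤ preorderRank L x := by
        exact_mod_cast hL.preorderRank_le_of_mem_branch hv x hx
      simp only [dot]
      linarith

theorem isMonotoneDrawing (hL : G.IsRootPathSystem L) :
    IsMonotoneDrawing G (gridMap (preorderDrawing L)) := by
  refine ⟨hL.isPlanarDrawing, fun a b hab => ?_⟩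
  rcases lt_or_gt_of_ne (hL.injective.ne hab) with h | h
  · obtain ⟨d, hd, hr⟩ := hL.exists_reflTransGen_monotoneStep_of_lt h
    exact exists_monotone_path_of_reflTransGen hd hr
  · obtain ⟨d, hd, hr⟩ := hL.exists_reflTransGen_monotoneStep_of_lt h
    exact exists_monotone_path_of_reflTransGen (neg_ne_zero.mpr hd)
      (reflTransGen_monotoneStep_reverse (by rwa [neg_neg]))

theorem preorderDrawing_bounds (hL : G.IsRootPathSystem L) (v : V) :
    0 ≤ (preorderDrawing L v).1 ∧ (preorderDrawing L v).1 ≤ Fintype.card V ∧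
      0 ≤ (preorderDrawing L v).2 ∧ (preorderDrawing L v).2 ≤ (Fintype.card V : ℤ) ^ 2 := by
  have hlen : ((L v).length : ℤ) ≤ Fintype.card V := by
    exact_mod_cast (hL.nodup v).length_le_card
  refine ⟨Int.natCast_nonneg _, hlen, List.sum_nonneg ?_, ?_⟩
  · intro y hy
    obtain ⟨x, -, rfl⟩ := List.mem_map.mp hy
    exact preorderRank_nonneg x
  · have h := List.sum_le_card_nsmul ((L v).map (preorderRank L)) (Fintype.card V : ℤ) (by
      intro y hy
      obtain ⟨x, -, rfl⟩ := List.mem_map.mp hy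
      exact preorderRank_le_card x)
    rw [List.length_map, nsmul_eq_mul] at h
    rw [sq]
    exact h.trans (mul_le_mul_of_nonneg_right hlen (Int.natCast_nonneg _))

end SimpleGraph.IsRootPathSystem

end Drawing

/-- Every tree on `n ≥ 2` vertices admits a monotone grid drawing
on the grid `[0, n] × [0, n²]`. -/
theorem tree_monotone_grid_drawing
    {V : Type} [Fintype V] (T : SimpleGraph V) (hT : T.IsTree)
    (n : ℕ) (hn : 2 ≤ n) (hcard : Fintype.card V = n) :
    ∃ f : V → ℤ × ℤ,
      IsMonotoneDrawing T (gridMap f) ∧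
      ∀ v : V,
        0 ≤ (f v).1 ∧ (f v).1 ≤ (n : ℤ) ∧
        0 ≤ (f v).2 ∧ (f v).2 ≤ (n : ℤ) ^ 2 := by
  subst hcard
  let e := Fintype.equivFin V
  let _ : LinearOrder V := LinearOrder.lift' e e.injective
  obtain ⟨L, hL⟩ := hT.exists_isRootPathSystem
  exact ⟨preorderDrawing L, hL.isMonotoneDrawing, hL.preorderDrawing_bounds⟩
end

section
/- Let T = (V,E) be a finite tree and let f : V → ℝ² be a drawing of T such that for every pair of distinct vertices a, b the unique path in T from a to b is monotone (with respect to some nonzero direction depending on the pair). Let {u,v} be an edge of T, let S be the vertex set of the connected component of T − {u,v} that contains v, and let t ≥ 0 be a real number. Define f_t : V → ℝ² by f_t(x) = f(x) + t·(f(v) − f(u)) for x ∈ S and f_t(x) = f(x) for x ∉ S. Then for every pair of distinct vertices a, b the unique path in T from a to b is monotone in the drawing f_t. -/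
open SimpleGraph

/-- Along each edge, the elongated drawing keeps the slope and orientation of the original one. -/
theorem exists_pos_smul_of_elongation {V : Type} {T : SimpleGraph V} (hT : T.IsAcyclic)
    {f ft : V → ℝ × ℝ} {u v : V} (huv : T.Adj u v) {t : ℝ} (ht : 0 ≤ t)
    (hin : ∀ x, (T.deleteEdges {s(u, v)}).Reachable v x → ft x = f x + t • (f v - f u))
    (hout : ∀ x, ¬ (T.deleteEdges {s(u, v)}).Reachable v x → ft x = f x)
    {x y : V} (hxy : T.Adj x y) :
    ∃ c : ℝ, 0 < c ∧ ft y - ft x = c • (f y - f x) := by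
  have hu : ¬ (T.deleteEdges {s(u, v)}).Reachable v u := fun h =>
    (isBridge_iff.mp (isAcyclic_iff_forall_adj_isBridge.mp hT huv)) h.symm
  have hv : (T.deleteEdges {s(u, v)}).Reachable v v := Reachable.refl v
  by_cases he : s(x, y) = s(u, v)
  · refine ⟨1 + t, by linarith, ?_⟩
    rcases Sym2.eq_iff.mp he with ⟨rfl, rfl⟩ | ⟨rfl, rfl⟩
    · rw [hin _ hv, hout _ hu]
      module
    · rw [hin _ hv, hout _ hu]
      module
  · have hadj : (T.deleteEdges {s(u, v)}).Adj x y := by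
      rw [deleteEdges_adj]
      exact ⟨hxy, by simpa using he⟩
    refine ⟨1, one_pos, ?_⟩
    by_cases hx : (T.deleteEdges {s(u, v)}).Reachable v x
    · rw [hin _ hx, hin _ (hx.trans hadj.reachable)]
      module
    · rw [hout _ hx, hout _ fun hy => hx (hy.trans hadj.symm.reachable)]
      module

theorem dot_smul_left (c : ℝ) (p q : ℝ × ℝ) : dot (c • p) q = c * dot p q := by
  simp only [dot, Prod.smul_fst, Prod.smul_snd, smul_eq_mul]
  ring

/-- Monotonicity of a walk only depends on the directions of the edges of the drawing. -/
theorem MonotoneWalk.of_pos_smul {V : Type} {G : SimpleGraph V} {f g : V → ℝ × ℝ}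
    (h : ∀ x y, G.Adj x y → ∃ c : ℝ, 0 < c ∧ g y - g x = c • (f y - f x))
    {a b : V} {w : G.Walk a b} (hw : MonotoneWalk f w) : MonotoneWalk g w := by
  obtain ⟨d, hd, hchain⟩ := hw
  refine ⟨d, hd, List.isChain_iff_getElem.mpr fun i hi => ?_⟩
  obtain ⟨c, hc, hcg⟩ := h _ _ (List.isChain_iff_getElem.mp w.isChain_adj_support i hi)
  rw [hcg, dot_smul_left]
  exact mul_pos hc (List.isChain_iff_getElem.mp hchain i hi)

/-- **elongation lemma.** Let `f` be a drawing of a finite tree `T`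
in which every tree path is monotone. Translating the component of `T − {u,v}`
containing `v` by `t·(f v − f u)`, `t ≥ 0`, keeps every tree path monotone. -/
theorem monotone_tree_drawing_elongation
    {V : Type} [Fintype V] (T : SimpleGraph V) (hT : T.IsTree)
    (f : V → ℝ × ℝ) (hinj : Function.Injective f)
    (hmono : ∀ a b : V, a ≠ b → ∀ w : T.Walk a b, w.IsPath → MonotoneWalk f w)
    (u v : V) (huv : T.Adj u v)
    (S : Set V) (hS : S = {x : V | (T.deleteEdges {s(u, v)}).Reachable v x})
    (t : ℝ) (ht : 0 ≤ t)
    (ft : V → ℝ × ℝ)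
    (hftS : ∀ x ∈ S, ft x = f x + t • (f v - f u))
    (hftS' : ∀ x ∉ S, ft x = f x) :
    ∀ a b : V, a ≠ b → ∀ w : T.Walk a b, w.IsPath → MonotoneWalk ft w := by
  subst hS
  intro a b hab w hw
  exact (hmono a b hab w hw).of_pos_smul fun _ _ =>
    exists_pos_smul_of_elongation hT.isAcyclic huv ht hftS hftS'
end

section
/- Let T be a finite tree on n ≥ 2 vertices rooted at a vertex r, and let σ be a bijection from V∖{r} to {1, 2, …, n−1} such that for every vertex u ≠ r the set of values that σ takes on the vertices of the subtree of T rooted at u is a set of consecutive integers whose maximum is σ(u). Define f : V → ℤ² by f(r) = (0,0) and f(v) = f(p(v)) + (1, σ(v)) for v ≠ r, where p(v) is the parent of v. Then f is injective, every vertex is placed at a grid point (x,y) with 0 ≤ x ≤ n−1 and 0 ≤ y ≤ n(n−1)/2, and f is a planar (crossing-free) straight-line drawing of T. -/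
open SimpleGraph

/-- In a tree with parent function `p`, every edge joins a vertex to its parent. -/
lemma adj_parent_cases {V : Type} [Fintype V] {T : SimpleGraph V} (hT : T.IsTree)
    {r : V} {p : V → V}
    (hp : ∀ v : V, v ≠ r → T.Adj (p v) v ∧ T.dist r (p v) + 1 = T.dist r v)
    {a b : V} (hab : T.Adj a b) :
    (b ≠ r ∧ a = p b) ∨ (a ≠ r ∧ b = p a) := by
  classical
  have hinj : Set.InjOn (fun v => s(p v, v)) (Finset.univ.erase r : Finset V) := by
    intro v hv w hw h
    have hv' : v ≠ r := by simpa using hv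
    have hw' : w ≠ r := by simpa using hw
    have h1 := (hp v hv').2
    have h2 := (hp w hw').2
    simp only [Sym2.eq_iff] at h
    rcases h with h | ⟨h, h'⟩
    · exact h.2
    · rw [h] at h1
      rw [← h'] at h2
      omega
  have hsub : (Finset.univ.erase r).image (fun v => s(p v, v)) ⊆ T.edgeFinset := by
    intro e he
    obtain ⟨v, hv, rfl⟩ := Finset.mem_image.1 he
    simpa using (hp v (by simpa using hv)).1
  have hcard : T.edgeFinset.card ≤ ((Finset.univ.erase r).image (fun v => s(p v, v))).card := by
    rw [Finset.card_image_of_injOn hinj, Finset.card_erase_of_mem (Finset.mem_univ r),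
      Finset.card_univ]
    have := hT.card_edgeFinset
    omega
  have heq := Finset.eq_of_subset_of_card_le hsub hcard
  have hmem : s(a, b) ∈ T.edgeFinset := by simpa using hab
  rw [← heq] at hmem
  obtain ⟨v, hv, h⟩ := Finset.mem_image.1 hmem
  have hv' : v ≠ r := by simpa using hv
  rcases Sym2.eq_iff.1 h with ⟨rfl, rfl⟩ | ⟨rfl, rfl⟩
  · exact Or.inl ⟨hv', rfl⟩
  · exact Or.inr ⟨hv', rfl⟩

/-- Induction along a parent function that decreases the distance to the root. -/
lemma parent_induction {V : Type} {T : SimpleGraph V} {r : V} {p : V → V}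
    (hp : ∀ v : V, v ≠ r → T.Adj (p v) v ∧ T.dist r (p v) + 1 = T.dist r v)
    {P : V → Prop} (root : P r) (step : ∀ v, v ≠ r → P (p v) → P v) (v : V) : P v := by
  generalize hk : T.dist r v = k
  induction k generalizing v with
  | zero =>
    by_cases hv : v = r
    · exact hv ▸ root
    · have := (hp v hv).2
      omega
  | succ k ih =>
    by_cases hv : v = r
    · exact hv ▸ root
    · have := (hp v hv).2
      exact step v hv (ih _ (by omega))

/-- The labels of the non-root vertices decrease from parent to child. -/
lemma label_lt_label_parent {V : Type} {T : SimpleGraph V} {r : V} {p : V → V}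
    (hp : ∀ v : V, v ≠ r → T.Adj (p v) v ∧ T.dist r (p v) + 1 = T.dist r v)
    {σ : V → ℕ} (hinj : Set.InjOn σ {v : V | v ≠ r})
    (hσsub : ∀ u : V, u ≠ r →
      ∃ m : ℕ,
        σ '' {x : V | T.dist r u + T.dist u x = T.dist r x} = Set.Icc m (σ u))
    {v : V} (hv : v ≠ r) (hpv : p v ≠ r) : σ v < σ (p v) := by
  obtain ⟨m, hm⟩ := hσsub (p v) hpv
  have hmem : σ v ∈ Set.Icc m (σ (p v)) := by
    rw [← hm]
    refine ⟨v, ?_, rfl⟩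
    have h1 := SimpleGraph.dist_eq_one_iff_adj.2 (hp v hv).1
    have h2 := (hp v hv).2
    rw [Set.mem_ofPred_eq]
    omega
  refine lt_of_le_of_ne hmem.2 fun h => (hp v hv).1.ne (hinj hv hpv h).symm

/-- Among vertices of equal depth, the order of the labels is inherited by distinct parents. -/
lemma label_parent_lt_of_label_lt {V : Type} [Fintype V] {T : SimpleGraph V} (hT : T.IsTree)
    {r : V} {p : V → V}
    (hp : ∀ v : V, v ≠ r → T.Adj (p v) v ∧ T.dist r (p v) + 1 = T.dist r v)
    {σ : V → ℕ} (hinj : Set.InjOn σ {v : V | v ≠ r})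
    (hσsub : ∀ u : V, u ≠ r →
      ∃ m : ℕ,
        σ '' {x : V | T.dist r u + T.dist u x = T.dist r x} = Set.Icc m (σ u))
    {u v : V} (hu : u ≠ r) (hv : v ≠ r) (hpu : p u ≠ r) (hpv : p v ≠ r)
    (hd : T.dist r u = T.dist r v) (hlt : σ u < σ v) (hne : p u ≠ p v) :
    σ (p u) < σ (p v) := by
  by_contra! hle
  have hpvu : σ v < σ (p u) := (label_lt_label_parent hp hinj hσsub hv hpv).trans_le hle
  have h1 := (hp u hu).2
  have h2 := (hp v hv).2
  obtain ⟨m, hm⟩ := hσsub (p u) hpu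
  have hmu : σ u ∈ Set.Icc m (σ (p u)) := by
    rw [← hm]
    refine ⟨u, ?_, rfl⟩
    have := SimpleGraph.dist_eq_one_iff_adj.2 (hp u hu).1
    rw [Set.mem_ofPred_eq]
    omega
  have hmv : σ v ∈ Set.Icc m (σ (p u)) := ⟨hmu.1.trans hlt.le, hpvu.le⟩
  rw [← hm] at hmv
  obtain ⟨x, hx, hxv⟩ := hmv
  rw [Set.mem_ofPred_eq] at hx
  have hxr : x ≠ r := by
    intro h
    rw [h, SimpleGraph.dist_self] at hx
    have := (hp _ hpu).2
    omega
  obtain rfl := hinj hxr hv hxv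
  have hadj : T.Adj (p u) x := SimpleGraph.dist_eq_one_iff_adj.1 (by omega)
  rcases adj_parent_cases hT hp hadj with ⟨-, h⟩ | ⟨-, h⟩
  · exact hne h
  · have := (hp _ hpu).2
    rw [← h] at this
    omega

/-- A point of the segment from `a` to `a + (1, s)` is determined by its horizontal offset. -/
lemma exists_offset_of_mem_segment {a b q : ℝ × ℝ} {s : ℝ} (hb : b = a + (1, s))
    (hq : q ∈ segment ℝ a b) :
    ∃ t : ℝ, 0 ≤ t ∧ t ≤ 1 ∧ q = (a.1 + t, a.2 + t * s) := by
  subst hb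
  rw [segment_eq_image'] at hq
  obtain ⟨t, ⟨h0, h1⟩, rfl⟩ := hq
  exact ⟨t, h0, h1, by ext <;> simp⟩

/-- Let `T` be a tree on `n ≥ 2` vertices rooted at `r`, with
parent function `p`, and let `σ` be a bijection from `V∖{r}` to `{1, …, n−1}`
such that on each subtree rooted at `u ≠ r` the values of `σ` form a set of
consecutive integers with maximum `σ u`. Then the map `f` defined by
`f r = (0,0)` and `f v = f (p v) + (1, σ v)` is injective, places every vertex
in `[0, n−1] × [0, n(n−1)/2]`, and is a planar straight-line drawing of `T`.
(The subtree rooted at `u` is the set of `x` with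
`dist r u + dist u x = dist r x`.) -/
theorem draw_monotone_tree_is_planar_grid_drawing
    {V : Type} [Fintype V] (T : SimpleGraph V) (hT : T.IsTree)
    (n : ℕ) (hn : 2 ≤ n) (hcard : Fintype.card V = n)
    (r : V) (p : V → V)
    (hp : ∀ v : V, v ≠ r → T.Adj (p v) v ∧ T.dist r (p v) + 1 = T.dist r v)
    (σ : V → ℕ)
    (hσbij : Set.BijOn σ {v : V | v ≠ r} (Set.Icc 1 (n - 1)))
    (hσsub : ∀ u : V, u ≠ r →
      ∃ m : ℕ,
        σ '' {x : V | T.dist r u + T.dist u x = T.dist r x} = Set.Icc m (σ u))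
    (f : V → ℤ × ℤ)
    (hfr : f r = (0, 0))
    (hf : ∀ v : V, v ≠ r → f v = f (p v) + (1, (σ v : ℤ))) :
    Function.Injective f ∧
    (∀ v : V,
      0 ≤ (f v).1 ∧ (f v).1 ≤ (n : ℤ) - 1 ∧
      0 ≤ (f v).2 ∧ (f v).2 ≤ (n : ℤ) * ((n : ℤ) - 1) / 2) ∧
    IsPlanarDrawing T (gridMap f) := by
  have hinj := hσbij.injOn
  have hσ1 : ∀ v, v ≠ r → 1 ≤ σ v ∧ σ v + 1 ≤ n := fun v hv => by
    have := hσbij.mapsTo hv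
    simp only [Set.mem_Icc] at this
    omega
  have hf1 : ∀ v, v ≠ r → (f v).1 = (f (p v)).1 + 1 := fun v hv => by rw [hf v hv]; rfl
  have hf2 : ∀ v, v ≠ r → (f v).2 = (f (p v)).2 + σ v := fun v hv => by rw [hf v hv]; rfl
  have hdist0 : ∀ v, T.dist r v = 0 → v = r := fun v h => by
    by_contra hv
    have := (hp v hv).2
    omega
  have hx : ∀ v, (f v).1 = T.dist r v := by
    refine parent_induction hp (by simp [hfr]) fun v hv ih => ?_
    rw [hf1 v hv, ih, ← (hp v hv).2]
    push_cast
    rfl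
  have hy0 : ∀ v, 0 ≤ (f v).2 := by
    refine parent_induction hp (by simp [hfr]) fun v hv ih => ?_
    rw [hf2 v hv]
    positivity
  have hxn : ∀ v, v ≠ r → (f v).1 + σ v ≤ n := by
    refine parent_induction hp (fun h => absurd rfl h) fun v hv ih _ => ?_
    rw [hf1 v hv]
    by_cases hpv : p v = r
    · have := hσ1 v hv
      rw [hpv, hfr]
      simp only
      omega
    · have := label_lt_label_parent hp hinj hσsub hv hpv
      have := ih hpv
      omega
  have hyn : ∀ v, v ≠ r → 2 * (f v).2 + σ v * (σ v - 1) ≤ (n : ℤ) * (n - 1) := by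
    refine parent_induction hp (fun h => absurd rfl h) fun v hv ih _ => ?_
    rw [hf2 v hv]
    by_cases hpv : p v = r
    · have h : (σ v : ℤ) + 1 ≤ n := by exact_mod_cast (hσ1 v hv).2
      rw [hpv, hfr]
      simp only
      nlinarith
    · have h : (σ v : ℤ) + 1 ≤ σ (p v) := by
        exact_mod_cast label_lt_label_parent hp hinj hσsub hv hpv
      have := ih hpv
      nlinarith
  have hord : ∀ u v, u ≠ r → v ≠ r → T.dist r u = T.dist r v → σ u < σ v →
      (f u).2 < (f v).2 ∧ (f (p u)).2 ≤ (f (p v)).2 := by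
    intro u
    induction u using parent_induction hp with
    | root => exact fun v h => absurd rfl h
    | step u hu ih =>
      intro v _ hv hd hlt
      have hle : (f (p u)).2 ≤ (f (p v)).2 := by
        by_cases hne : p u = p v
        · rw [hne]
        have h1 := (hp u hu).2
        have h2 := (hp v hv).2
        have hd' : T.dist r (p u) = T.dist r (p v) := by omega
        have hpu : p u ≠ r := fun h => hne (by
          rw [h]
          refine (hdist0 _ ?_).symm
          rw [← hd', h, SimpleGraph.dist_self])
        have hpv : p v ≠ r := fun h => hne (by
          rw [h]
          refine hdist0 _ ?_
          rw [hd', h, SimpleGraph.dist_self])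
        exact (ih _ hpu hpv hd'
          (label_parent_lt_of_label_lt hT hp hinj hσsub hu hv hpu hpv hd hlt hne)).1.le
      refine ⟨?_, hle⟩
      rw [hf2 u hu, hf2 v hv]
      omega
  have hfinj : Function.Injective f := by
    intro u v huv
    have hd : T.dist r u = T.dist r v := by
      have h1 := hx u
      have h2 := hx v
      rw [huv] at h1
      omega
    by_cases hu : u = r
    · subst hu
      exact (hdist0 v (by rw [← hd, SimpleGraph.dist_self])).symm
    by_cases hv : v = r
    · subst hv
      exact hdist0 u (by rw [hd, SimpleGraph.dist_self])
    rcases lt_trichotomy (σ u) (σ v) with h | h | h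
    · have := (hord u v hu hv hd h).1
      rw [huv] at this
      exact absurd this (lt_irrefl _)
    · exact hinj hu hv h
    · have := (hord v u hv hu hd.symm h).1
      rw [huv] at this
      exact absurd this (lt_irrefl _)
  have hginj : Function.Injective (gridMap f) := by
    intro u v h
    simp only [gridMap, Prod.mk.injEq, Int.cast_inj] at h
    exact hfinj (Prod.ext h.1 h.2)
  have hg : ∀ v, v ≠ r → gridMap f v = gridMap f (p v) + (1, (σ v : ℝ)) := fun v hv => by
    simp [gridMap, hf v hv]
  have hcross : ∀ v w, v ≠ r → w ≠ r → v ≠ w → ∀ q : ℝ × ℝ,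
      q ∈ segment ℝ (gridMap f (p v)) (gridMap f v) →
      q ∈ segment ℝ (gridMap f (p w)) (gridMap f w) →
      ∃ x : V, (x = p v ∨ x = v) ∧ (x = p w ∨ x = w) ∧ q = gridMap f x := by
    intro v w hv hw hvw q hqv hqw
    obtain ⟨t, ht0, ht1, hqt⟩ := exists_offset_of_mem_segment (hg v hv) hqv
    obtain ⟨s, hs0, hs1, hqs⟩ := exists_offset_of_mem_segment (hg w hw) hqw
    have hts := hqt.symm.trans hqs
    have ht_end : t = 1 → q = gridMap f v := by
      rintro rfl
      rw [hqt, hg v hv]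
      ext <;> simp
    have hs_end : s = 1 → q = gridMap f w := by
      rintro rfl
      rw [hqs, hg w hw]
      ext <;> simp
    have ht_start : t = 0 → q = gridMap f (p v) := by
      rintro rfl
      rw [hqt]
      ext <;> simp
    have hs_start : s = 0 → q = gridMap f (p w) := by
      rintro rfl
      rw [hqs]
      ext <;> simp
    obtain ⟨hX, hY⟩ := Prod.mk.inj hts
    simp only [gridMap] at hX hY
    rcases lt_trichotomy (f (p v)).1 (f (p w)).1 with h | h | h
    · have h' : ((f (p v)).1 : ℝ) + 1 ≤ (f (p w)).1 := by exact_mod_cast h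
      have h1 := ht_end (by linarith)
      have h2 := hs_start (by linarith)
      exact ⟨v, Or.inr rfl, Or.inl (hginj (h1.symm.trans h2)), h1⟩
    · have hst : t = s := by
        rw [h] at hX
        linarith
      subst hst
      have hd : T.dist r v = T.dist r w := by
        have h1 := hx v
        have h2 := hx w
        rw [hf1 v hv, h, ← hf1 w hw] at h1
        omega
      have ht : t = 0 := by
        rcases lt_trichotomy (σ v) (σ w) with hσ | hσ | hσ
        · have h1 : ((f (p v)).2 : ℝ) ≤ (f (p w)).2 := by
            exact_mod_cast (hord v w hv hw hd hσ).2
          have h2 : (σ v : ℝ) + 1 ≤ σ w := by exact_mod_cast hσ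
          nlinarith
        · exact absurd (hinj hv hw hσ) hvw
        · have h1 : ((f (p w)).2 : ℝ) ≤ (f (p v)).2 := by
            exact_mod_cast (hord w v hw hv hd.symm hσ).2
          have h2 : (σ w : ℝ) + 1 ≤ σ v := by exact_mod_cast hσ
          nlinarith
      have h1 := ht_start ht
      have h2 := hs_start ht
      exact ⟨p v, Or.inl rfl, Or.inl (hginj (h1.symm.trans h2)), h1⟩
    · have h' : ((f (p w)).1 : ℝ) + 1 ≤ (f (p v)).1 := by exact_mod_cast h
      have h1 := ht_start (by linarith)
      have h2 := hs_end (by linarith)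
      exact ⟨p v, Or.inl rfl, Or.inr (hginj (h1.symm.trans h2)), h1⟩
  have hopen : ∀ v c, v ≠ r →
      gridMap f c ∉ openSegment ℝ (gridMap f (p v)) (gridMap f v) := by
    intro v c hv hc
    rw [hg v hv, openSegment_eq_image'] at hc
    obtain ⟨t, ⟨h0, h1⟩, ht⟩ := hc
    have hX : ((f (p v)).1 : ℝ) + t = (f c).1 := by
      simpa [gridMap] using congrArg Prod.fst ht
    have h2 : (f (p v)).1 < (f c).1 := by
      have : ((f (p v)).1 : ℝ) < (f c).1 := by linarith
      exact_mod_cast this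
    have h3 : (f c).1 < (f (p v)).1 + 1 := by
      have : ((f c).1 : ℝ) < (f (p v)).1 + 1 := by linarith
      exact_mod_cast this
    omega
  refine ⟨hfinj, fun v => ⟨by rw [hx]; positivity, ?_, hy0 v, ?_⟩, hginj, ?_, ?_⟩
  · by_cases hv : v = r
    · rw [hv, hfr]
      simp only
      omega
    · have := hxn v hv
      have := hσ1 v hv
      omega
  · rw [Int.le_ediv_iff_mul_le (by norm_num)]
    by_cases hv : v = r
    · rw [hv, hfr]
      have : (2 : ℤ) ≤ n := by exact_mod_cast hn
      simp only
      nlinarith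
    · have h1 := hyn v hv
      have h2 : (1 : ℤ) ≤ σ v := by exact_mod_cast (hσ1 v hv).1
      nlinarith
  · intro a b c d hab hcd hne q hq1 hq2
    rcases adj_parent_cases hT hp hab with ⟨hb, rfl⟩ | ⟨ha, rfl⟩ <;>
      rcases adj_parent_cases hT hp hcd with ⟨hd, rfl⟩ | ⟨hc, rfl⟩
    · exact hcross b d hb hd (by rintro rfl; exact hne rfl) q hq1 hq2
    · rw [segment_symm] at hq2
      obtain ⟨x, h1, h2, h3⟩ :=
        hcross b c hb hc (by rintro rfl; exact hne Sym2.eq_swap) q hq1 hq2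
      exact ⟨x, h1, h2.symm, h3⟩
    · rw [segment_symm] at hq1
      obtain ⟨x, h1, h2, h3⟩ :=
        hcross a d ha hd (by rintro rfl; exact hne Sym2.eq_swap) q hq1 hq2
      exact ⟨x, h1.symm, h2, h3⟩
    · rw [segment_symm] at hq1 hq2
      obtain ⟨x, h1, h2, h3⟩ :=
        hcross a c ha hc (by rintro rfl; exact hne rfl) q hq1 hq2
      exact ⟨x, h1.symm, h2.symm, h3⟩
  · intro a b c hab _ _ hc
    rcases adj_parent_cases hT hp hab with ⟨hb, rfl⟩ | ⟨ha, rfl⟩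
    · exact hopen b c hb hc
    · rw [openSegment_symm] at hc
      exact hopen a c ha hc
end

section
/- Let T be a finite tree on n ≥ 2 vertices rooted at a vertex r, and let σ be a bijection from V∖{r} to {1, 2, …, n−1} such that for every vertex u ≠ r the set of values that σ takes on the vertices of the subtree of T rooted at u is a set of consecutive integers whose maximum is σ(u). Define f : V → ℤ² by f(r) = (0,0) and f(v) = f(p(v)) + (1, σ(v)) for v ≠ r, where p(v) is the parent of v. Then for every pair of distinct vertices a, b of T there exists a nonzero vector d ∈ ℝ² such that the unique path a = v_0, v_1, …, v_k = b in T satisfies ⟨f(v_{i+1}) − f(v_i), d⟩ > 0 for every 0 ≤ i < k; that is, every tree path is monotone in the drawing f. -/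
open SimpleGraph

namespace SimpleGraph

variable {V : Type} {T : SimpleGraph V} {r : V} {p : V → V}

/-- The vertices `x` such that some geodesic from the root `r` to `x` passes through `u`. In a
tree this is the subtree rooted at `u`. -/
def descendants (T : SimpleGraph V) (r u : V) : Set V :=
  {x | T.dist r u + T.dist u x = T.dist r x}

theorem self_mem_descendants {u : V} : u ∈ T.descendants r u := by
  simp [descendants]

theorem Connected.mem_descendants_of_adj (hT : T.Connected) {u x y : V}
    (hx : x ∈ T.descendants r u) (hxy : T.Adj x y) (hdist : T.dist r x + 1 = T.dist r y) :
    y ∈ T.descendants r u := by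
  simp only [descendants, Set.mem_ofPred_eq] at hx ⊢
  have h₁ := hT.dist_triangle (u := r) (v := u) (w := y)
  have h₂ := hT.dist_triangle (u := u) (v := x) (w := y)
  rw [dist_eq_one_iff_adj.mpr hxy] at h₂
  omega

/-- In a tree, a vertex has at most one ancestor at a given distance from the root. -/
theorem IsTree.eq_of_mem_descendants (hT : T.IsTree) {u v x : V}
    (hu : x ∈ T.descendants r u) (hv : x ∈ T.descendants r v)
    (hdist : T.dist r u = T.dist r v) : u = v := by
  simp only [descendants, Set.mem_ofPred_eq] at hu hv
  obtain ⟨q₁, hq₁⟩ := hT.connected.exists_walk_length_eq_dist r u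
  obtain ⟨q₂, hq₂⟩ := hT.connected.exists_walk_length_eq_dist u x
  obtain ⟨s₁, hs₁⟩ := hT.connected.exists_walk_length_eq_dist r v
  obtain ⟨s₂, hs₂⟩ := hT.connected.exists_walk_length_eq_dist v x
  have hq : (q₁.append q₂).IsPath :=
    (q₁.append q₂).isPath_of_length_eq_dist (by rw [Walk.length_append, hq₁, hq₂, hu])
  have hs : (s₁.append s₂).IsPath :=
    (s₁.append s₂).isPath_of_length_eq_dist (by rw [Walk.length_append, hs₁, hs₂, hv])
  have heq : q₁.append q₂ = s₁.append s₂ := (hT.existsUnique_path r x).unique hq hs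
  have h := congrArg (fun q => q.getVert (T.dist r u)) heq
  simpa [Walk.getVert_append, hq₁, hs₁, ← hdist] using h

/-- `p` maps every non-root vertex of `T` to a neighbor that is closer to the root `r`. -/
def IsParentMap (T : SimpleGraph V) (r : V) (p : V → V) : Prop :=
  ∀ v : V, v ≠ r → T.Adj (p v) v ∧ T.dist r (p v) + 1 = T.dist r v

theorem IsTree.eq_parent_of_adj (hT : T.IsTree) (hp : T.IsParentMap r p) {x y : V}
    (hxy : T.Adj x y) : (x ≠ r ∧ p x = y) ∨ (y ≠ r ∧ p y = x) := by
  wlog hlt : T.dist r x < T.dist r y generalizing x y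
  · have hne := hT.dist_ne_of_adj r hxy
    exact (this hxy.symm (by omega)).symm
  right
  have hy : y ≠ r := by
    rintro rfl
    simp at hlt
  have htri := hT.connected.dist_triangle (u := r) (v := x) (w := y)
  rw [dist_eq_one_iff_adj.mpr hxy] at htri
  obtain ⟨hadj, hdist⟩ := hp y hy
  exact ⟨hy, hT.eq_of_mem_descendants
    (hT.connected.mem_descendants_of_adj self_mem_descendants hadj hdist)
    (hT.connected.mem_descendants_of_adj self_mem_descendants hxy (by omega)) (by omega)⟩

/-- A path in a tree that starts at a descendant of `u` and avoids the parent of its starting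
vertex only descends. -/
theorem IsTree.isChain_support_of_parent_notMem (hT : T.IsTree) (hp : T.IsParentMap r p) {u : V}
    {x b : V} (w : T.Walk x b) (hw : w.IsPath) (hx : x ∈ T.descendants r u)
    (hpx : p x ∉ w.support) :
    w.support.IsChain fun y z => (z ≠ r ∧ p z = y) ∧ z ∈ T.descendants r u := by
  induction w with
  | nil => simp
  | @cons x z b h w ih =>
    rw [Walk.cons_isPath_iff] at hw
    obtain ⟨-, rfl⟩ | ⟨hz, rfl⟩ := hT.eq_parent_of_adj hp h
    · simp at hpx
    · have hzu := hT.connected.mem_descendants_of_adj hx h (hp z hz).2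
      have hchain := ih hw.1 hzu hw.2
      rw [Walk.support_cons, ← Walk.cons_tail_support w, List.isChain_cons_cons,
        Walk.cons_tail_support w]
      exact ⟨⟨⟨hz, rfl⟩, hzu⟩, hchain⟩

/-- A path in a rooted tree only ascends, or only descends, or ascends in the subtree of a
vertex `u` and then descends in the subtree of a sibling `v` of `u`. -/
theorem IsTree.isChain_support_of_isPath (hT : T.IsTree) (hp : T.IsParentMap r p) {a b : V}
    (w : T.Walk a b) (hw : w.IsPath) :
    (w.support.IsChain fun y z => y ≠ r ∧ p y = z) ∨
    (∃ v, v ≠ r ∧ p v = a ∧ v ∈ w.support ∧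
      w.support.IsChain fun y z => (z ≠ r ∧ p z = y) ∧ z ∈ T.descendants r v) ∨
    ∃ u v, u ≠ r ∧ v ≠ r ∧ p u = p v ∧ u ≠ v ∧ a ∈ T.descendants r u ∧
      w.support.IsChain fun y z =>
        ((y ≠ r ∧ p y = z) ∧ y ∈ T.descendants r u) ∨
        ((z ≠ r ∧ p z = y) ∧ z ∈ T.descendants r v) := by
  induction w with
  | nil => simp
  | @cons a z b h w ih =>
    rw [Walk.cons_isPath_iff] at hw
    rw [Walk.support_cons, ← Walk.cons_tail_support w]
    simp only [List.isChain_cons_cons]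
    rw [Walk.cons_tail_support w]
    obtain ⟨ha, rfl⟩ | ⟨hz, rfl⟩ := hT.eq_parent_of_adj hp h
    · rcases ih hw.1 with hup | ⟨v, hv, hpv, hvw, hdown⟩ | ⟨u, v, hu, hv, hpuv, huv, hau, hmix⟩
      · exact .inl ⟨⟨ha, rfl⟩, hup⟩
      · exact .inr <| .inr ⟨a, v, ha, hv, hpv.symm, fun hav => hw.2 (hav ▸ hvw),
          self_mem_descendants, .inl ⟨⟨ha, rfl⟩, self_mem_descendants⟩,
          hdown.imp fun _ _ => .inr⟩
      · have hau' := hT.connected.mem_descendants_of_adj hau h.symm (hp a ha).2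
        exact .inr <| .inr ⟨u, v, hu, hv, hpuv, huv, hau', .inl ⟨⟨ha, rfl⟩, hau'⟩, hmix⟩
    · exact .inr <| .inl ⟨z, hz, rfl, by simp, ⟨⟨hz, rfl⟩, self_mem_descendants⟩,
        hT.isChain_support_of_parent_notMem hp w hw.1 self_mem_descendants hw.2⟩

end SimpleGraph

/-- With the slope assignment of Algorithm Draw-Monotone-Tree
(`σ` a bijection from `V∖{r}` to `{1, …, n−1}` assigning consecutive values with
maximum `σ u` to each subtree rooted at `u`), the drawing `f` defined by
`f r = (0,0)` and `f v = f (p v) + (1, σ v)` makes every tree path monotone: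
for all distinct `a, b` the unique path from `a` to `b` admits a nonzero
direction `d` along which all its edges have positive inner product. -/
theorem draw_monotone_tree_paths_are_monotone
    {V : Type} [Fintype V] (T : SimpleGraph V) (hT : T.IsTree)
    (n : ℕ) (hn : 2 ≤ n) (hcard : Fintype.card V = n)
    (r : V) (p : V → V)
    (hp : ∀ v : V, v ≠ r → T.Adj (p v) v ∧ T.dist r (p v) + 1 = T.dist r v)
    (σ : V → ℕ)
    (hσbij : Set.BijOn σ {v : V | v ≠ r} (Set.Icc 1 (n - 1)))
    (hσsub : ∀ u : V, u ≠ r →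
      ∃ m : ℕ,
        σ '' {x : V | T.dist r u + T.dist u x = T.dist r x} = Set.Icc m (σ u))
    (f : V → ℤ × ℤ)
    (hfr : f r = (0, 0))
    (hf : ∀ v : V, v ≠ r → f v = f (p v) + (1, (σ v : ℤ))) :
    ∀ a b : V, a ≠ b → ∀ w : T.Walk a b, w.IsPath →
      MonotoneWalk (gridMap f) w := by
  intro a b hab w hw
  have hdown : ∀ {z}, z ≠ r → gridMap f z - gridMap f (p z) = (1, (σ z : ℝ)) := by
    intro z hz
    ext <;> simp [gridMap, hf z hz]
  have hup : ∀ {z}, z ≠ r → gridMap f (p z) - gridMap f z = (-1, -(σ z : ℝ)) := by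
    intro z hz
    rw [← neg_sub, hdown hz, Prod.neg_mk]
  have hle : ∀ u ≠ r, ∀ x ∈ T.descendants r u, σ x ≤ σ u := by
    intro u hu x hx
    obtain ⟨m, hm⟩ := hσsub u hu
    exact (hm.subset ⟨x, hx, rfl⟩).2
  have hlt : ∀ u v, u ≠ r → v ≠ r → p u = p v → u ≠ v → σ u < σ v →
      ∀ x ∈ T.descendants r v, σ u < σ x := by
    intro u v hu hv hpuv huv huv' x hx
    obtain ⟨m, hm⟩ := hσsub v hv
    by_contra! hxu
    obtain ⟨y, hy, hyu⟩ := hm.superset ⟨(hm.subset ⟨x, hx, rfl⟩).1.trans hxu, huv'.le⟩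
    have hyr : y ≠ r := by
      rintro rfl
      have := hT.connected.pos_dist_of_ne hv.symm
      simp only [Set.mem_ofPred_eq, dist_self] at hy
      omega
    obtain rfl := hσbij.injOn hyr hu hyu
    have hdist : T.dist r y = T.dist r v := by
      rw [← (hp y hu).2, ← (hp v hv).2, hpuv]
    exact huv (hT.eq_of_mem_descendants self_mem_descendants hy hdist)
  rcases hT.isChain_support_of_isPath hp w hw with h | ⟨v, -, -, -, h⟩ |
    ⟨u, v, hu, hv, hpuv, huv, -, h⟩
  · refine ⟨(-1, 0), by simp, h.imp ?_⟩
    rintro x _ ⟨hx, rfl⟩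
    simp [hup hx, dot]
  · refine ⟨(1, 0), by simp, h.imp ?_⟩
    rintro _ y ⟨⟨hy, rfl⟩, -⟩
    simp [hdown hy, dot]
  · have hσuv : σ u ≠ σ v := fun h => huv (hσbij.injOn hu hv h)
    rcases hσuv.lt_or_gt with hlt' | hlt'
    · refine ⟨(-(σ u + 1 / 2), 1), by simp, h.imp ?_⟩
      rintro x y (⟨⟨hx, rfl⟩, hxu⟩ | ⟨⟨hy, rfl⟩, hyv⟩)
      · have : (σ x : ℝ) ≤ σ u := by exact_mod_cast hle u hu x hxu
        simp only [hup hx, dot]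
        linarith
      · have : (σ u : ℝ) + 1 ≤ σ y := by exact_mod_cast hlt u v hu hv hpuv huv hlt' y hyv
        simp only [hdown hy, dot]
        linarith
    · refine ⟨(σ v + 1 / 2, -1), by simp, h.imp ?_⟩
      rintro x y (⟨⟨hx, rfl⟩, hxu⟩ | ⟨⟨hy, rfl⟩, hyv⟩)
      · have : (σ v : ℝ) + 1 ≤ σ x := by
          exact_mod_cast hlt v u hv hu hpuv.symm huv.symm hlt' x hxu
        simp only [hup hx, dot]
        linarith
      · have : (σ y : ℝ) ≤ σ v := by exact_mod_cast hle v hv y hyv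
        simp only [hdown hy, dot]
        linarith
end

section
/- Let p_0, p_1, …, p_k be points in ℝ² and let 0 ≤ j ≤ k be an index such that for every i < j one has p_{i+1} − p_i = (−1, −s_i) for some real s_i ∈ A, and for every i with j ≤ i < k one has p_{i+1} − p_i = (1, s_i) for some real s_i ∈ B, where A and B are sets of reals admitting a real number m with a < m < b for all a ∈ A, b ∈ B, or with a > m > b for all a ∈ A, b ∈ B. Then there exists a nonzero vector d ∈ ℝ² such that ⟨p_{i+1} − p_i, d⟩ > 0 for every 0 ≤ i < k; that is, the polygonal path p_0, …, p_k is monotone with respect to the direction d. -/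
/-- A polygonal path which first goes along steps `(−1, −s)`
with `s ∈ A` and then along steps `(1, s)` with `s ∈ B`, where some real `m`
separates `A` from `B` (either `a < m < b` or `a > m > b` for all `a ∈ A`,
`b ∈ B`), is monotone with respect to some nonzero direction `d`. -/
theorem polygonal_path_monotone_of_separated_slopes
    (k j : ℕ) (hjk : j ≤ k) (p : ℕ → ℝ × ℝ) (A B : Set ℝ)
    (hA : ∀ i : ℕ, i < j → ∃ s ∈ A, p (i + 1) - p i = (-1, -s))
    (hB : ∀ i : ℕ, j ≤ i → i < k → ∃ s ∈ B, p (i + 1) - p i = (1, s))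
    (hsep : (∃ m : ℝ, (∀ a ∈ A, a < m) ∧ (∀ b ∈ B, m < b)) ∨
            (∃ m : ℝ, (∀ a ∈ A, m < a) ∧ (∀ b ∈ B, b < m))) :
    ∃ d : ℝ × ℝ, d ≠ 0 ∧ ∀ i : ℕ, i < k → 0 < dot (p (i + 1) - p i) d := by
  rcases hsep with ⟨m, hAm, hBm⟩ | ⟨m, hAm, hBm⟩
  · refine ⟨(-m, 1), by simp, fun i hi => ?_⟩
    rcases lt_or_ge i j with hij | hij
    · obtain ⟨s, hs, h⟩ := hA i hij
      rw [h, dot]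
      linarith [hAm s hs]
    · obtain ⟨s, hs, h⟩ := hB i hij hi
      rw [h, dot]
      linarith [hBm s hs]
  · refine ⟨(m, -1), by simp, fun i hi => ?_⟩
    rcases lt_or_ge i j with hij | hij
    · obtain ⟨s, hs, h⟩ := hA i hij
      rw [h, dot]
      linarith [hAm s hs]
    · obtain ⟨s, hs, h⟩ := hB i hij hi
      rw [h, dot]
      linarith [hBm s hs]
end
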